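/- arXiv:2303.00828 — 5 statements merged into one kernel-verified Lean document; each statement's English description precedes it below -/
import Mathlib

section
/- Every sum-free set A ⊆ F_5^2 with |A| ≥ 5 is isomorphic (via an invertible linear map of F_5^2) to a set containing the three points (1,0), (1,1), and (1,2). -/
/-- A finite set with no solution of `a + b = c` and no nonconstant three-term progression. -/
def SumAndProgressionFree (S : Finset (ZMod 5 × ZMod 5)) : Prop :=
  ∀ a ∈ S, ∀ b ∈ S, a + b ∉ S ∧ (a ≠ b → b + b - a ∉ S)

instance : DecidablePred SumAndProgressionFree := fun S => by
  unfold SumAndProgressionFree; infer_instance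

lemma SumAndProgressionFree.mono {S T : Finset (ZMod 5 × ZMod 5)}
    (hT : SumAndProgressionFree T) (h : S ⊆ T) : SumAndProgressionFree S :=
  fun a ha b hb => ⟨fun hc => (hT a (h ha) b (h hb)).1 (h hc),
    fun hne hc => (hT a (h ha) b (h hb)).2 hne (h hc)⟩

lemma not_sumAndProgressionFree_five :
    ∀ x : ZMod 5 × ZMod 5, x ∉ ({(1, 0), (0, 1)} : Finset (ZMod 5 × ZMod 5)) →
      SumAndProgressionFree {(1, 0), (0, 1), x} →
    ∀ y : ZMod 5 × ZMod 5, y ∉ ({(1, 0), (0, 1), x} : Finset (ZMod 5 × ZMod 5)) →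
      SumAndProgressionFree {(1, 0), (0, 1), x, y} →
    ∀ z : ZMod 5 × ZMod 5, z ∉ ({(1, 0), (0, 1), x, y} : Finset (ZMod 5 × ZMod 5)) →
      ¬ SumAndProgressionFree {(1, 0), (0, 1), x, y, z} := by
  decide +kernel

lemma SumAndProgressionFree.card_le_four {S : Finset (ZMod 5 × ZMod 5)}
    (hS : SumAndProgressionFree S) (h₁ : (1, 0) ∈ S) (h₂ : (0, 1) ∈ S) : S.card ≤ 4 := by
  by_contra! hlt
  have exists_new : ∀ T : Finset (ZMod 5 × ZMod 5), T.card ≤ 4 → ∃ x ∈ S, x ∉ T :=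
    fun T hT => Finset.exists_mem_notMem_of_card_lt_card (by omega)
  obtain ⟨x, hxS, hx⟩ := exists_new {(1, 0), (0, 1)} (Finset.card_le_two.trans (by norm_num))
  obtain ⟨y, hyS, hy⟩ := exists_new {(1, 0), (0, 1), x} (Finset.card_le_three.trans (by norm_num))
  obtain ⟨z, hzS, hz⟩ := exists_new {(1, 0), (0, 1), x, y} Finset.card_le_four
  refine not_sumAndProgressionFree_five x hx (hS.mono ?_) y hy (hS.mono ?_) z hz (hS.mono ?_) <;>
    simp [Finset.insert_subset_iff, *]

/-- Two vectors with nonzero determinant can be moved to the standard basis. -/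
lemma exists_linearEquiv_standard_basis {K : Type*} [Field K] (u v : K × K)
    (h : u.1 * v.2 - u.2 * v.1 ≠ 0) :
    ∃ φ : (K × K) ≃ₗ[K] (K × K), φ u = (1, 0) ∧ φ v = (0, 1) := by
  obtain ⟨u₁, u₂⟩ := u
  obtain ⟨v₁, v₂⟩ := v
  obtain ⟨d, hd⟩ : ∃ d, d = u₁ * v₂ - u₂ * v₁ := ⟨_, rfl⟩
  have hd₀ : d ≠ 0 := hd ▸ h
  let φ : (K × K) ≃ₗ[K] (K × K) :=
    { toFun := fun x => ((x.1 * v₂ - x.2 * v₁) / d, (u₁ * x.2 - u₂ * x.1) / d)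
      invFun := fun p => p.1 • (u₁, u₂) + p.2 • (v₁, v₂)
      map_add' := fun x y => by ext <;> simp <;> ring
      map_smul' := fun c x => by ext <;> simp <;> ring
      left_inv := fun x => by ext <;> simp <;> field_simp <;> rw [hd] <;> ring
      right_inv := fun x => by ext <;> simp <;> field_simp <;> rw [hd] <;> ring }
  refine ⟨φ, ?_, ?_⟩
  · ext
    · simp [φ, ← hd, hd₀]
    · simp [φ, mul_comm]
  · ext
    · simp [φ, mul_comm]
    · simp [φ, ← hd, hd₀]

lemma eq_smul_of_det_eq_zero :
    ∀ a : ZMod 5 × ZMod 5, a ≠ 0 → ∀ b : ZMod 5 × ZMod 5, a.1 * b.2 - a.2 * b.1 = 0 →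
      b = 0 ∨ b = a ∨ b = a + a ∨ a = b + b ∨ b = -a := by
  decide +kernel

lemma neg_add_neg_sub_eq : ∀ a : ZMod 5 × ZMod 5, -a + -a - a = a + a := by
  decide +kernel

lemma eq_or_eq_neg_of_det_eq_zero {A : Set (ZMod 5 × ZMod 5)}
    (hsf : ∀ a ∈ A, ∀ b ∈ A, a + b ∉ A) {a b : ZMod 5 × ZMod 5} (ha : a ∈ A) (hb : b ∈ A)
    (hdet : a.1 * b.2 - a.2 * b.1 = 0) : b = a ∨ b = -a := by
  have ne_zero : ∀ c ∈ A, c ≠ 0 := by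
    rintro c hc rfl
    exact hsf 0 hc 0 hc (by simpa using hc)
  rcases eq_smul_of_det_eq_zero a (ne_zero a ha) b hdet with h | h | h | h | h
  · exact absurd h (ne_zero b hb)
  · exact .inl h
  · exact absurd (h ▸ hb) (hsf a ha a ha)
  · exact absurd (h ▸ ha) (hsf b hb b hb)
  · exact .inr h

theorem stmt_2 (A : Set (ZMod 5 × ZMod 5))
    (hsf : ∀ a ∈ A, ∀ b ∈ A, a + b ∉ A)
    (hcard : 5 ≤ A.ncard) :
    ∃ φ : (ZMod 5 × ZMod 5) ≃ₗ[ZMod 5] (ZMod 5 × ZMod 5),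
      ((1, 0) : ZMod 5 × ZMod 5) ∈ φ '' A ∧
      ((1, 1) : ZMod 5 × ZMod 5) ∈ φ '' A ∧
      ((1, 2) : ZMod 5 × ZMod 5) ∈ φ '' A := by
  classical
  have : Fact (Nat.Prime 5) := ⟨by norm_num⟩
  by_contra hno
  have progression_free : ∀ a ∈ A, ∀ b ∈ A, a ≠ b → b + b - a ∉ A := by
    intro a ha b hb hne hc
    by_cases hdet : a.1 * b.2 - a.2 * b.1 = 0
    · rcases eq_or_eq_neg_of_det_eq_zero hsf ha hb hdet with h | h
      · exact hne h.symm
      · rw [h, neg_add_neg_sub_eq] at hc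
        exact hsf a ha a ha hc
    · obtain ⟨φ, h₁, h₂⟩ := exists_linearEquiv_standard_basis a (b - a) (by
        intro h
        apply hdet
        simp only [Prod.fst_sub, Prod.snd_sub] at h
        linear_combination h)
      have hb' : φ b = (1, 1) := by
        rw [← sub_add_cancel b a, map_add, h₁, h₂]
        simp
      refine hno ⟨φ, ⟨a, ha, h₁⟩, ⟨b, hb, hb'⟩, ⟨_, hc, ?_⟩⟩
      rw [map_sub, map_add, hb', h₁]
      rfl
  obtain ⟨a, ha⟩ : A.Nonempty := Set.nonempty_of_ncard_ne_zero (by omega)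
  obtain ⟨b, hb, hdet⟩ : ∃ b ∈ A, a.1 * b.2 - a.2 * b.1 ≠ 0 := by
    by_contra! hall
    have hsub : A ⊆ {a, -a} := fun b hb => eq_or_eq_neg_of_det_eq_zero hsf ha hb (hall b hb)
    have := (Set.ncard_le_ncard hsub).trans (Set.ncard_insert_le a {-a})
    rw [Set.ncard_singleton] at this
    omega
  obtain ⟨φ, h₁, h₂⟩ := exists_linearEquiv_standard_basis a b hdet
  have hfree : SumAndProgressionFree (φ '' A).toFinset := by
    intro x hx y hy
    rw [Set.mem_toFinset] at hx hy
    obtain ⟨x, hx, rfl⟩ := hx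
    obtain ⟨y, hy, rfl⟩ := hy
    rw [← map_add, ← map_add, ← map_sub, Set.mem_toFinset, Set.mem_toFinset,
      φ.injective.mem_set_image, φ.injective.mem_set_image]
    exact ⟨hsf x hx y hy, fun hne => progression_free x hx y hy fun h => hne (h ▸ rfl)⟩
  have hle := hfree.card_le_four (Set.mem_toFinset.2 ⟨a, ha, h₁⟩) (Set.mem_toFinset.2 ⟨b, hb, h₂⟩)
  rw [← Set.ncard_eq_toFinset_card', Set.ncard_image_of_injective _ φ.injective] at hle
  omega
end

section
/- If A ⊆ F_5^2 is sum-free with |A| ≥ 5, then there exists a 1-dimensional subspace V < F_5^2 such that (A + A) ∪ (A − A) contains two distinct cosets of V. -/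
open Pointwise

/-- No sum of two entries of `L` is an entry of `L`. -/
def IsSumFreeList (L : List (ZMod 5 × ZMod 5)) : Prop :=
  ∀ a ∈ L, ∀ b ∈ L, a + b ∉ L

instance : DecidablePred IsSumFreeList := fun L => by
  unfold IsSumFreeList; infer_instance

/-- Every point of the line through `c` in direction `v` is a sum or a difference of entries
of `L`. -/
def CoversLine (L : List (ZMod 5 × ZMod 5)) (v c : ZMod 5 × ZMod 5) : Prop :=
  ∀ t : ZMod 5, ∃ a ∈ L, ∃ b ∈ L, c + t • v = a + b ∨ c + t • v = a - b

instance (L : List (ZMod 5 × ZMod 5)) (v c : ZMod 5 × ZMod 5) : Decidable (CoversLine L v c) := by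
  unfold CoversLine; infer_instance

/-- A vector independent of `v ≠ 0`, since `2` is not a square modulo `5`. -/
def transversal (v : ZMod 5 × ZMod 5) : ZMod 5 × ZMod 5 := (2 * v.2, v.1)

/-- One vector spanning each line through the origin. -/
def directions : List (ZMod 5 × ZMod 5) := [(0, 1), (1, 0), (1, 1), (1, 2), (1, 3), (1, 4)]

theorem ne_zero_of_mem_directions : ∀ v ∈ directions, v ≠ 0 := by decide +kernel

/-- In some direction, two distinct parallel lines are covered by the sums and differences
of entries of `L`. -/
def HasTwoParallelLines (L : List (ZMod 5 × ZMod 5)) : Prop :=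
  ∃ v ∈ directions, ∃ s : ZMod 5, CoversLine L v (s • transversal v) ∧
    ∃ s' : ZMod 5, s' ≠ s ∧ CoversLine L v (s' • transversal v)

instance : DecidablePred HasTwoParallelLines := fun L => by
  unfold HasTwoParallelLines; infer_instance

theorem hasTwoParallelLines_of_isSumFreeList : ∀ x y : ZMod 5 × ZMod 5,
    [(1, 0), (0, 1), x, y].Nodup → IsSumFreeList [(1, 0), (0, 1), x, y] →
    HasTwoParallelLines [(1, 0), (0, 1), x, y] ∨
    ∀ z : ZMod 5 × ZMod 5, z ∉ [(1, 0), (0, 1), x, y] →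
      IsSumFreeList [(1, 0), (0, 1), x, y, z] →
      HasTwoParallelLines [(1, 0), (0, 1), x, y, z] := by
  decide +kernel

theorem eq_zero_of_smul_transversal_eq_smul : ∀ v : ZMod 5 × ZMod 5, v ≠ 0 →
    ∀ s t : ZMod 5, s • transversal v = t • v → s = 0 := by
  unfold transversal; decide +kernel

/-- A sum-free set of at least five points containing the standard basis covers two parallel lines. -/
theorem exists_two_parallel_lines_of_standard_basis_mem (B : Set (ZMod 5 × ZMod 5))
    (hsf : ∀ a ∈ B, ∀ b ∈ B, a + b ∉ B) (hcard : 5 ≤ B.ncard)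
    (h₁ : (1, 0) ∈ B) (h₂ : (0, 1) ∈ B) :
    ∃ v : ZMod 5 × ZMod 5, v ≠ 0 ∧ ∃ c c' : ZMod 5 × ZMod 5, (∀ t : ZMod 5, c - c' ≠ t • v) ∧
      (∀ t : ZMod 5, c + t • v ∈ (B + B) ∪ (B - B)) ∧
      ∀ t : ZMod 5, c' + t • v ∈ (B + B) ∪ (B - B) := by
  have mem_of_covers {L : List (ZMod 5 × ZMod 5)} (hL : ∀ a ∈ L, a ∈ B)
      {v c : ZMod 5 × ZMod 5} (h : CoversLine L v c) (t : ZMod 5) :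
      c + t • v ∈ (B + B) ∪ (B - B) := by
    obtain ⟨a, ha, b, hb, h | h⟩ := h t
    · exact Or.inl (h ▸ Set.add_mem_add (hL a ha) (hL b hb))
    · exact Or.inr (h ▸ Set.sub_mem_sub (hL a ha) (hL b hb))
  have sumFree {L : List (ZMod 5 × ZMod 5)} (hL : ∀ a ∈ L, a ∈ B) : IsSumFreeList L :=
    fun a ha b hb hab => hsf a (hL a ha) b (hL b hb) (hL _ hab)
  have exists_new (L : List (ZMod 5 × ZMod 5)) (hL : L.length < 5) : ∃ x ∈ B, x ∉ L := by
    obtain ⟨x, hx, hxL⟩ := Set.exists_mem_notMem_of_ncard_lt_ncard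
      (s := (L.toFinset : Set (ZMod 5 × ZMod 5))) (t := B) (by
        rw [Set.ncard_coe_finset]
        exact (L.toFinset_card_le.trans_lt hL).trans_le hcard)
    exact ⟨x, hx, by simpa using hxL⟩
  obtain ⟨x, hx, hx'⟩ := exists_new [(1, 0), (0, 1)] (by simp)
  obtain ⟨y, hy, hy'⟩ := exists_new [(1, 0), (0, 1), x] (by simp)
  obtain ⟨z, hz, hz'⟩ := exists_new [(1, 0), (0, 1), x, y] (by simp)
  have hL₄ : ∀ a ∈ [(1, 0), (0, 1), x, y], a ∈ B := by simp [*]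
  have hL₅ : ∀ a ∈ [(1, 0), (0, 1), x, y, z], a ∈ B := by simp [*]
  have hnodup : [(1, 0), (0, 1), x, y].Nodup := by
    simp only [List.mem_cons, List.not_mem_nil, or_false, not_or] at hx' hy'
    have one_ne_zero : (1 : ZMod 5) ≠ 0 := by decide
    simp [one_ne_zero, Ne.symm hx'.1, Ne.symm hx'.2, Ne.symm hy'.1, Ne.symm hy'.2.1, Ne.symm hy'.2.2]
  obtain ⟨L, hL, v, hv, s, hs, s', hne, hs'⟩ : ∃ L, (∀ a ∈ L, a ∈ B) ∧ HasTwoParallelLines L := by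
    obtain h | h := hasTwoParallelLines_of_isSumFreeList x y hnodup (sumFree hL₄)
    · exact ⟨_, hL₄, h⟩
    · exact ⟨_, hL₅, h z hz' (sumFree hL₅)⟩
  have hv₀ := ne_zero_of_mem_directions v hv
  refine ⟨v, hv₀, _, _, fun t ht => hne ?_, mem_of_covers hL hs, mem_of_covers hL hs'⟩
  rw [← sub_smul] at ht
  exact (sub_eq_zero.1 (eq_zero_of_smul_transversal_eq_smul v hv₀ _ t ht)).symm

/-- A sum-free set of at least three points contains two independent vectors. -/
theorem exists_linearIndependent_pair_of_sumFree {E : Type*} [AddCommGroup E] [Module (ZMod 5) E]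
    (A : Set E) (hsf : ∀ a ∈ A, ∀ b ∈ A, a + b ∉ A) (hcard : 3 ≤ A.ncard) :
    ∃ u ∈ A, ∃ w ∈ A, ∀ s t : ZMod 5, s • u + t • w = 0 → s = 0 ∧ t = 0 := by
  have values : ∀ r : ZMod 5, r = 0 ∨ r = 1 ∨ r = 2 ∨ r = 3 ∨ r = -1 := by decide
  have : Fact (Nat.Prime 5) := ⟨by norm_num⟩
  obtain ⟨u, hu⟩ := Set.nonempty_of_ncard_ne_zero (by omega : A.ncard ≠ 0)
  have h₀ : (0 : E) ∉ A := fun h => hsf 0 h 0 h (by simpa using h)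
  have hu₀ : u ≠ 0 := fun h => h₀ (h ▸ hu)
  obtain ⟨w, hw, hwu⟩ := Set.exists_mem_notMem_of_ncard_lt_ncard
    (s := {u, -u}) (t := A) ((Set.ncard_insert_le _ _).trans_lt (by rw [Set.ncard_singleton]; omega))
  have hne : ∀ r : ZMod 5, r • u ≠ w := by
    rintro r rfl
    rcases values r with rfl | rfl | rfl | rfl | rfl
    · exact h₀ (by simpa using hw)
    · simp at hwu
    · exact hsf u hu u hu (by simpa [two_smul] using hw)
    · refine hsf _ hw _ hw ?_
      rw [← add_smul, show (3 + 3 : ZMod 5) = 1 from rfl, one_smul]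
      exact hu
    · simp at hwu
  refine ⟨u, hu, w, hw, fun s t h => ?_⟩
  have ht : t = 0 := by
    by_contra ht
    refine hne (-(t⁻¹ * s)) ?_
    have hs : s • u = -(t • w) := eq_neg_of_add_eq_zero_left h
    rw [neg_smul, mul_smul, hs, smul_neg, neg_neg, inv_smul_smul₀ ht]
  subst ht
  simpa [hu₀] using h

theorem stmt_3 (A : Set (ZMod 5 × ZMod 5))
    (hsf : ∀ a ∈ A, ∀ b ∈ A, a + b ∉ A)
    (hcard : 5 ≤ A.ncard) :
    ∃ V : Submodule (ZMod 5) (ZMod 5 × ZMod 5), Module.finrank (ZMod 5) V = 1 ∧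
      ∃ c₁ c₂ : ZMod 5 × ZMod 5, c₁ - c₂ ∉ V ∧
        c₁ +ᵥ (V : Set (ZMod 5 × ZMod 5)) ⊆ (A + A) ∪ (A - A) ∧
        c₂ +ᵥ (V : Set (ZMod 5 × ZMod 5)) ⊆ (A + A) ∪ (A - A) := by
  have : Fact (Nat.Prime 5) := ⟨by norm_num⟩
  obtain ⟨u, hu, w, hw, huw⟩ := exists_linearIndependent_pair_of_sumFree A hsf (by omega)
  let φ : ZMod 5 × ZMod 5 →ₗ[ZMod 5] ZMod 5 × ZMod 5 :=
    (LinearMap.toSpanSingleton _ _ u).coprod (LinearMap.toSpanSingleton _ _ w)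
  have hφ (p : ZMod 5 × ZMod 5) : φ p = p.1 • u + p.2 • w := by simp [φ]
  have hinj : Function.Injective φ := by
    refine (injective_iff_map_eq_zero φ).2 fun p hp => ?_
    rw [hφ] at hp
    exact Prod.ext_iff.2 (huw _ _ hp)
  have hsurj : Function.Surjective φ := Finite.surjective_of_injective hinj
  obtain ⟨v, hv, c, c', hcc', hc, hc'⟩ :=
    exists_two_parallel_lines_of_standard_basis_mem (φ ⁻¹' A)
      (fun a ha b hb => by simpa using hsf _ ha _ hb)
      (by rwa [Set.ncard_preimage_of_injective_subset_range hinj (by simp [hsurj.range_eq])])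
      (by simpa [hφ] using hu) (by simpa [hφ] using hw)
  have himage {d : ZMod 5 × ZMod 5}
      (hd : ∀ t : ZMod 5, d + t • v ∈ (φ ⁻¹' A + φ ⁻¹' A) ∪ (φ ⁻¹' A - φ ⁻¹' A)) :
      φ d +ᵥ (Submodule.span (ZMod 5) {φ v} : Set (ZMod 5 × ZMod 5)) ⊆ (A + A) ∪ (A - A) := by
    rintro _ ⟨x, hx, rfl⟩
    obtain ⟨t, rfl⟩ := Submodule.mem_span_singleton.1 hx
    have h := Set.mem_image_of_mem φ (hd t)
    rw [Set.image_union, Set.image_add, Set.image_sub, Set.image_preimage_eq A hsurj] at h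
    simpa using h
  refine ⟨Submodule.span (ZMod 5) {φ v}, finrank_span_singleton ?_, φ c, φ c', ?_,
    himage hc, himage hc'⟩
  · simpa using hinj.ne hv
  · rw [Submodule.mem_span_singleton]
    rintro ⟨t, ht⟩
    rw [← map_smul, ← map_sub] at ht
    exact hcc' t (hinj ht).symm
end

section
/- For n ≥ 2 and any sum-free set A ⊆ F_5^n with |A| > 1.2 · 5^{n−1}, there exists a subspace W < F_5^n of codimension 1 such that |A ∩ W| ≥ |A|/5. -/
open Finset Module

theorem fact_prime_five : Fact (Nat.Prime 5) := ⟨Nat.prime_five⟩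

section

attribute [local instance] fact_prime_five

section SumFree

variable {V : Type*} [AddCommGroup V] [Module (ZMod 5) V]

/-- A sum-free set cannot contain exactly one nonzero multiple of every nonzero vector, unless it
has at most one element. -/
theorem subsingleton_of_sumFree_of_transversal {A : Set V}
    (hsf : ∀ a ∈ A, ∀ b ∈ A, a + b ∉ A)
    (hunique : ∀ v ∈ A, ∀ t : ZMod 5, t • v ∈ A → t = 1)
    (hmeets : ∀ v : V, v ≠ 0 → ∃ t : ZMod 5, t • v ∈ A) : A.Subsingleton := by
  have h0 : (0 : V) ∉ A := fun h => hsf 0 h 0 h (by simpa using h)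
  have h5 : (5 : ZMod 5) = 0 := by decide
  have hdiff : ∀ x ∈ A, ∀ y ∈ A, x ≠ y →
      (2 : ZMod 5) • (x - y) ∈ A ∨ (2 : ZMod 5) • (y - x) ∈ A := by
    intro x hx y hy hxy
    obtain ⟨t, ht⟩ := hmeets (x - y) (sub_ne_zero.mpr hxy)
    have hcases : ∀ t : ZMod 5, t = 0 ∨ t = 1 ∨ t = 2 ∨ t = -2 ∨ t = -1 := by decide
    rcases hcases t with rfl | rfl | rfl | rfl | rfl
    · exact absurd (by simpa using ht) h0
    · exact absurd (by simpa using hx) (hsf _ ht _ hy)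
    · exact .inl ht
    · refine .inr ?_
      convert ht using 1
      module
    · refine absurd ?_ (hsf _ ht _ hx)
      convert hy using 1
      module
  have hconfig : ∀ w ∈ A, ∀ c ∈ A, w + (2 : ZMod 5) • c ∉ A := by
    intro w hw c hc hu
    have hsum : (3 : ZMod 5) • (w + c) ∈ A := by
      have hne : w + (2 : ZMod 5) • c ≠ c := by
        intro h
        have hwc : (-1 : ZMod 5) • c = w := by linear_combination (norm := module) -h
        exact absurd (hunique c hc (-1) (hwc ▸ hw)) (by decide)
      rcases hdiff _ hu _ hc hne with h | h
      · refine absurd ?_ (hsf _ hw _ hu)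
        convert h using 1
        module
      · convert h using 1
        linear_combination (norm := module) h5 • (w + c)
    have hne : (3 : ZMod 5) • (w + c) ≠ w := by
      intro h
      have hcw : c = w := by
        linear_combination (norm := module) (2 : ZMod 5) • h - h5 • c - h5 • w
      exact absurd (hunique c hc 3 (by convert hu using 1; rw [← hcw]; module)) (by decide)
    rcases hdiff _ hsum _ hw hne with h | h
    · refine hsf _ h _ hw ?_
      convert hc using 1
      linear_combination (norm := module) h5 • (w + c)
    · refine hsf _ h _ hc ?_
      convert hw using 1
      linear_combination (norm := module) -h5 • (w + c)
  intro x hx y hy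
  by_contra hxy
  rcases hdiff x hx y hy hxy with h | h
  · refine hconfig x hx _ h ?_
    convert hy using 1
    linear_combination (norm := module) h5 • (x - y)
  · refine hconfig y hy _ h ?_
    convert hx using 1
    linear_combination (norm := module) h5 • (y - x)

open Classical in
theorem five_mul_card_le_of_sumFree [Fintype V] {A : Finset V}
    (hsf : ∀ a ∈ A, ∀ b ∈ A, a + b ∉ A) : 5 * #A ≤ 2 * Fintype.card V := by
  obtain rfl | ⟨a, ha⟩ := A.eq_empty_or_nonempty
  · simp
  have htranslate : ∀ t : ZMod 5, ∑ x : V, (if x + t • a ∈ A then 1 else 0) = #A := by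
    intro t
    refine ((Equiv.addRight (t • a)).bijective.sum_comp
      fun x : V => if x ∈ A then 1 else 0).trans ?_
    simp
  have hcoset : ∀ x : V, ∑ t : ZMod 5, (if x + t • a ∈ A then 1 else 0) ≤ 2 := by
    intro x
    have hnext : ∀ t : ZMod 5, (if x + t • a ∈ A then 1 else 0) +
        (if x + (t + 1) • a ∈ A then 1 else 0) ≤ 1 := by
      intro t
      have h := fun hx => hsf (x + t • a) hx a ha
      rw [show x + t • a + a = x + (t + 1) • a by module] at h
      split_ifs <;> simp_all
    have hdouble := sum_le_sum fun t (_ : t ∈ (univ : Finset (ZMod 5))) => hnext t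
    have hshift : ∑ t : ZMod 5, (if x + (t + 1) • a ∈ A then 1 else 0) =
        ∑ t : ZMod 5, (if x + t • a ∈ A then 1 else 0) :=
      (Equiv.addRight (1 : ZMod 5)).bijective.sum_comp
        fun t : ZMod 5 => if x + t • a ∈ A then 1 else 0
    rw [sum_add_distrib, hshift] at hdouble
    simp only [sum_const, card_univ, ZMod.card, smul_eq_mul] at hdouble
    omega
  calc 5 * #A = ∑ t : ZMod 5, ∑ x : V, (if x + t • a ∈ A then 1 else 0) := by
        simp only [htranslate, sum_const, card_univ, ZMod.card, smul_eq_mul]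
    _ = ∑ x : V, ∑ t : ZMod 5, (if x + t • a ∈ A then 1 else 0) := sum_comm
    _ ≤ ∑ x : V, 2 := sum_le_sum fun x _ => hcoset x
    _ = 2 * Fintype.card V := by simp [mul_comm]

end SumFree

section Hyperplanes

variable {V : Type*} [AddCommGroup V] [Module (ZMod 5) V] [FiniteDimensional (ZMod 5) V]

theorem card_dualAnnihilator_mul_card (U : Submodule (ZMod 5) V) :
    Nat.card U.dualAnnihilator * 5 ^ finrank (ZMod 5) U = 5 ^ finrank (ZMod 5) V := by
  rw [← Subspace.finrank_add_finrank_dualAnnihilator_eq U,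
    Module.natCard_eq_pow_finrank (K := ZMod 5), Nat.card_zmod, add_comm, pow_add]

variable [Fintype (Dual (ZMod 5) V)]

open Classical in
theorem card_vanishing_mul_card (s : Set V) :
    #{f : Dual (ZMod 5) V | ∀ x ∈ s, f x = 0} * 5 ^ finrank (ZMod 5) (Submodule.span (ZMod 5) s) =
      5 ^ finrank (ZMod 5) V := by
  rw [← card_dualAnnihilator_mul_card (Submodule.span (ZMod 5) s)]
  congr 1
  refine (Nat.subtype_card _ fun f => ?_).symm
  rw [mem_filter_univ, ← SetLike.mem_coe, Submodule.coe_dualAnnihilator_span]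
  rfl

open Classical in
theorem card_dual_vanishing {v : V} (hv : v ≠ 0) :
    5 * #{f : Dual (ZMod 5) V | f v = 0} = 5 ^ finrank (ZMod 5) V := by
  have h := card_vanishing_mul_card {v}
  rw [finrank_span_singleton hv] at h
  simp only [Set.mem_singleton_iff, forall_eq] at h
  omega

open Classical in
theorem card_dual_vanishing_pair {v a : V} (hv : v ≠ 0) (ha : ∀ t : ZMod 5, t • v ≠ a) :
    25 * #{f : Dual (ZMod 5) V | f v = 0 ∧ f a = 0} = 5 ^ finrank (ZMod 5) V := by
  have h := card_vanishing_mul_card (Set.range ![v, a])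
  rw [finrank_span_eq_card ((LinearIndependent.pair_iff' hv).mpr ha)] at h
  simp only [Set.forall_mem_range, Fin.forall_fin_two, Matrix.cons_val_zero, Matrix.cons_val_one,
    Fintype.card_fin] at h
  omega

end Hyperplanes

section Averaging

variable {V : Type*} [AddCommGroup V] [Module (ZMod 5) V] {A : Finset V}

open Classical in
theorem sum_card_filter_comm (S : Finset (Dual (ZMod 5) V)) :
    ∑ f ∈ S, #{a ∈ A | f a = 0} = ∑ a ∈ A, #{f ∈ S | f a = 0} :=
  sum_card_bipartiteAbove_eq_sum_card_bipartiteBelow fun (f : Dual (ZMod 5) V) a => f a = 0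

variable [FiniteDimensional (ZMod 5) V] [Fintype (Dual (ZMod 5) V)]

open Classical in
/-- Averaging `#(A ∩ ker f)` over the nonzero functionals `f` that vanish at `v`. -/
theorem card_multiples_mul_lt {m : ℕ} (hdim : 25 * m = 5 ^ finrank (ZMod 5) V)
    (hA : ∀ f : Dual (ZMod 5) V, f ≠ 0 → 5 * #{a ∈ A | f a = 0} < #A)
    {v : V} (hv : v ≠ 0) (hm : 1 < 5 * m) :
    #{a ∈ A | ∃ t : ZMod 5, t • v = a} * (5 * m) < #A := by
  set S : Finset (Dual (ZMod 5) V) := {f | f v = 0} with hS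
  have hScard : #S = 5 * m := by
    have := card_dual_vanishing hv
    rw [hS]
    omega
  have h0 : (0 : Dual (ZMod 5) V) ∈ S := by simp [hS]
  have hinner : ∀ a ∈ A, #{f ∈ S | f a = 0} =
      m + if ∃ t : ZMod 5, t • v = a then 4 * m else 0 := by
    intro a _
    split_ifs with h
    · obtain ⟨t, rfl⟩ := h
      rw [filter_true_of_mem, hScard]
      · ring
      · intro f hf
        simp_all
    · push Not at h
      have := card_dual_vanishing_pair hv h
      rw [hS, filter_filter]
      omega
  have hsum := sum_card_filter_comm (A := A) S
  rw [sum_congr rfl hinner, sum_add_distrib, ← sum_filter, sum_const, sum_const, smul_eq_mul,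
    smul_eq_mul, ← add_sum_erase _ _ h0] at hsum
  simp only [LinearMap.zero_apply, filter_true] at hsum
  have hne : (S.erase 0).Nonempty := by
    rw [← card_pos, card_erase_of_mem h0]
    omega
  have hlt : ∑ f ∈ S.erase 0, 5 * #{a ∈ A | f a = 0} < ∑ f ∈ S.erase 0, #A :=
    sum_lt_sum_of_nonempty hne fun f hf => hA f (ne_of_mem_erase hf)
  rw [← mul_sum, sum_const, card_erase_of_mem h0, hScard, smul_eq_mul] at hlt
  obtain ⟨q, hq⟩ : ∃ q, 5 * m = q + 1 := ⟨5 * m - 1, by omega⟩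
  rw [hq, Nat.add_sub_cancel] at hlt
  rw [hq]
  nlinarith

open Classical in
/-- Averaging `#(A ∩ ker f)` over the functionals `f` that do not vanish at `v`. -/
theorem exists_smul_mem_of_card_lt {m : ℕ} (hdim : 25 * m = 5 ^ finrank (ZMod 5) V)
    (hA : ∀ f : Dual (ZMod 5) V, f ≠ 0 → 5 * #{a ∈ A | f a = 0} < #A)
    {v : V} (hv : v ≠ 0) (h0 : (0 : V) ∉ A) : ∃ t : ZMod 5, t • v ∈ A := by
  by_contra! hno
  set T : Finset (Dual (ZMod 5) V) := {f | f v ≠ 0} with hT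
  have hinner : ∀ a ∈ A, #{f ∈ T | f a = 0} = 4 * m := by
    intro a ha
    have hpair := card_dual_vanishing_pair hv (a := a) fun t ht => hno t (ht ▸ ha)
    have hone := card_dual_vanishing (v := a) fun h => h0 (h ▸ ha)
    have hsplit := card_filter_add_card_filter_not (s := {f : Dual (ZMod 5) V | f a = 0})
      (fun f => f v = 0)
    simp only [filter_filter] at hsplit
    simp only [hT, filter_filter, and_comm, ne_eq] at hsplit hpair ⊢
    omega
  have hTcard : #T = 20 * m := by
    have hsplit := card_filter_add_card_filter_not (s := (univ : Finset (Dual (ZMod 5) V)))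
      (fun f => f v = 0)
    have hone := card_dual_vanishing hv
    have hall : #(univ : Finset (Dual (ZMod 5) V)) = 5 ^ finrank (ZMod 5) V := by
      rw [card_univ, ← Nat.card_eq_fintype_card, Module.natCard_eq_pow_finrank (K := ZMod 5),
        Nat.card_zmod, Subspace.dual_finrank_eq]
    change _ + #T = _ at hsplit
    omega
  have hpos : 0 < 5 ^ finrank (ZMod 5) V := by positivity
  have hlt : ∑ f ∈ T, 5 * #{a ∈ A | f a = 0} < ∑ f ∈ T, #A := by
    refine sum_lt_sum_of_nonempty (card_pos.mp (by omega)) fun f hf => hA f ?_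
    rintro rfl
    simp [hT] at hf
  rw [← mul_sum, sum_card_filter_comm, sum_congr rfl hinner, sum_const, sum_const, hTcard,
    smul_eq_mul, smul_eq_mul] at hlt
  nlinarith

open Classical in
theorem exists_card_le_five_mul_card_ker [Fintype V] (hdim : 2 ≤ finrank (ZMod 5) V)
    (hsf : ∀ a ∈ A, ∀ b ∈ A, a + b ∉ A) (htwo : 1 < #A) :
    ∃ f : Dual (ZMod 5) V, f ≠ 0 ∧ #A ≤ 5 * #{a ∈ A | f a = 0} := by
  by_contra! hA
  obtain ⟨d, hd⟩ := Nat.exists_eq_add_of_le hdim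
  have hm : 25 * 5 ^ d = 5 ^ finrank (ZMod 5) V := by rw [hd, pow_add]; norm_num
  have hpos : 0 < 5 ^ d := by positivity
  have h0 : (0 : V) ∉ A := fun h => hsf 0 h 0 h (by simpa using h)
  have hle := five_mul_card_le_of_sumFree hsf
  rw [Module.card_eq_pow_finrank (K := ZMod 5) (V := V), ZMod.card, ← hm] at hle
  refine (one_lt_card.mp htwo).elim fun x ⟨hx, y, hy, hxy⟩ => hxy <|
    subsingleton_of_sumFree_of_transversal (A := (A : Set V)) hsf ?_
      (fun v hv => exists_smul_mem_of_card_lt hm hA hv h0) hx hy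
  intro v hv t ht
  have hv0 : v ≠ 0 := fun h => h0 (h ▸ hv)
  have hlt := card_multiples_mul_lt hm hA hv0 (by omega)
  have hone : #{a ∈ A | ∃ t : ZMod 5, t • v = a} ≤ 1 := by
    by_contra! h
    nlinarith
  have heq : t • v = v := card_le_one.mp hone _ (mem_filter.mpr ⟨ht, t, rfl⟩) _
    (mem_filter.mpr ⟨hv, 1, one_smul _ _⟩)
  exact smul_left_injective (ZMod 5) hv0 (by simpa using heq)

end Averaging

end

theorem stmt_5 (n : ℕ) (hn : 2 ≤ n) (A : Set (Fin n → ZMod 5))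
    (hsf : ∀ a ∈ A, ∀ b ∈ A, a + b ∉ A)
    (hcard : 5 * A.ncard > 6 * 5 ^ (n - 1)) :
    ∃ W : Submodule (ZMod 5) (Fin n → ZMod 5), Module.finrank (ZMod 5) W = n - 1 ∧
      5 * (A ∩ (W : Set (Fin n → ZMod 5))).ncard ≥ A.ncard := by
  classical
  have := fact_prime_five
  have := Module.finite_of_finite (ZMod 5) (M := Dual (ZMod 5) (Fin n → ZMod 5))
  have := Fintype.ofFinite (Dual (ZMod 5) (Fin n → ZMod 5))
  have hpos : 0 < 5 ^ (n - 1) := by positivity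
  obtain ⟨f, hf, hle⟩ := exists_card_le_five_mul_card_ker (A := A.toFinset) (by simpa using hn)
    (by simpa using hsf) (by rw [← Set.ncard_eq_toFinset_card']; omega)
  refine ⟨LinearMap.ker f, ?_, ?_⟩
  · have := Dual.finrank_ker_add_one_of_ne_zero hf
    rw [finrank_fin_fun] at this
    omega
  · rw [Set.ncard_eq_toFinset_card', Set.ncard_eq_toFinset_card' A]
    convert hle using 3
    ext a
    simp
end

section
/- Let p ≥ 11 be a prime with p ≡ 2 mod 3, m = (p+1)/3, and A₂ = {(m−1,0),(2m−1,p−1)} ∪ {m} × (F_p \ {p−1}) ∪ {2m−2} × (F_p \ {0}) ∪ {m+1,...,2m−3} × F_p ⊆ F_p^2. Then A₂ is sum-free, |A₂| = (m−1)p, and A₂ is not contained in m cosets of any single 1-dimensional subspace that form an arithmetic progression of cosets (A₂ is not normal). -/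
open Pointwise

theorem ZMod.eq_natCast_iff_val_eq {n k : ℕ} [NeZero n] (hk : k < n) (x : ZMod n) :
    x = (k : ZMod n) ↔ x.val = k := by
  constructor
  · rintro rfl
    exact ZMod.val_cast_of_lt hk
  · rintro rfl
    exact (ZMod.natCast_zmod_val x).symm

theorem ZMod.ncard_natCast_image_Icc {n a b : ℕ} (hb : b < n) :
    ((fun k : ℕ => (k : ZMod n)) '' Set.Icc a b).ncard = b + 1 - a := by
  have : NeZero n := ⟨by omega⟩
  rw [Set.InjOn.ncard_image, Set.ncard_eq_toFinset_card']
  · simp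
  · intro x hx y hy hxy
    rw [← ZMod.val_cast_of_lt (hx.2.trans_lt hb), ← ZMod.val_cast_of_lt (hy.2.trans_lt hb)]
    exact congrArg ZMod.val hxy

theorem ZMod.exists_natCast_eq_iff_val_mem {p a b : ℕ} [NeZero p] (hb : b < p) (x : ZMod p) :
    (∃ k : ℕ, a ≤ k ∧ k ≤ b ∧ x = (k : ZMod p)) ↔
      a ≤ x.val ∧ x.val ≤ b := by
  constructor
  · rintro ⟨k, h1, h2, h3⟩
    rw [ZMod.eq_natCast_iff_val_eq (by omega)] at h3
    omega
  · rintro ⟨h1, h2⟩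
    exact ⟨x.val, h1, h2, (ZMod.natCast_zmod_val x).symm⟩

/-- The non-normal sum-free set in `ZMod p × ZMod p`. -/
def nonNormalSumFreeSet (p m : ℕ) : Set (ZMod p × ZMod p) :=
  {(((m - 1 : ℕ) : ZMod p), (0 : ZMod p)),
    (((2 * m - 1 : ℕ) : ZMod p), (-1 : ZMod p))} ∪
  {x | x.1 = ((m : ℕ) : ZMod p) ∧ x.2 ≠ -1} ∪
  {x | x.1 = ((2 * m - 2 : ℕ) : ZMod p) ∧ x.2 ≠ 0} ∪
  {x | ∃ k : ℕ, m + 1 ≤ k ∧ k ≤ 2 * m - 3 ∧ x.1 = (k : ZMod p)}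

theorem mem_nonNormalSumFreeSet_iff {p m : ℕ} [NeZero p] (hpm : p = 3 * m - 1) (hm4 : 4 ≤ m)
    (x : ZMod p × ZMod p) : x ∈ nonNormalSumFreeSet p m ↔
    m - 1 ≤ x.1.val ∧ x.1.val ≤ 2 * m - 1 ∧ (x.1.val = m - 1 → x.2 = 0) ∧
    (x.1.val = 2 * m - 1 → x.2 = -1) ∧ (x.1.val = m → x.2 ≠ -1) ∧
    (x.1.val = 2 * m - 2 → x.2 ≠ 0) := by
  simp only [nonNormalSumFreeSet, Set.mem_union, Set.mem_insert_iff,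
    Set.mem_singleton_iff, Set.mem_ofPred_eq, Prod.ext_iff,
    ZMod.exists_natCast_eq_iff_val_mem (show 2 * m - 3 < p by omega)]
  repeat rw [ZMod.eq_natCast_iff_val_eq (by omega)]
  by_cases h0 : x.2 = 0 <;> by_cases h1 : x.2 = -1 <;> simp only [h0, h1] <;> grind

theorem ZMod.neg_one_add_neg_one_ne_zero {p : ℕ} (hp : 2 < p) : (-1 + -1 : ZMod p) ≠ 0 := by
  intro h
  have h2 : ((2 : ℕ) : ZMod p) = 0 := by
    push_cast
    linear_combination -h
  rw [ZMod.natCast_eq_zero_iff] at h2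
  exact absurd (Nat.le_of_dvd two_pos h2) (by omega)

theorem cases_of_add_mod_mem_Icc {m u v : ℕ} (hm : 2 ≤ m) (hu : m - 1 ≤ u ∧ u ≤ 2 * m - 1)
    (hv : m - 1 ≤ v ∧ v ≤ 2 * m - 1)
    (hr : m - 1 ≤ (u + v) % (3 * m - 1) ∧ (u + v) % (3 * m - 1) ≤ 2 * m - 1) :
    (u = m - 1 ∧ v = m - 1 ∧ (u + v) % (3 * m - 1) = 2 * m - 2) ∨
    (u = m - 1 ∧ v = m ∧ (u + v) % (3 * m - 1) = 2 * m - 1) ∨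
    (u = m ∧ v = m - 1 ∧ (u + v) % (3 * m - 1) = 2 * m - 1) ∨
    (u = 2 * m - 1 ∧ v = 2 * m - 1 ∧ (u + v) % (3 * m - 1) = m - 1) := by
  rcases lt_or_ge (u + v) (3 * m - 1) with h | h
  · rw [Nat.mod_eq_of_lt h] at hr ⊢
    omega
  · rw [Nat.mod_eq_sub_mod h, Nat.mod_eq_of_lt (by omega)] at hr ⊢
    omega

theorem add_notMem_nonNormalSumFreeSet {p m : ℕ} [NeZero p] (hpm : p = 3 * m - 1) (hm4 : 4 ≤ m)
    (a : ZMod p × ZMod p) (ha : a ∈ nonNormalSumFreeSet p m) (b : ZMod p × ZMod p)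
    (hb : b ∈ nonNormalSumFreeSet p m) : a + b ∉ nonNormalSumFreeSet p m := by
  intro hab
  rw [mem_nonNormalSumFreeSet_iff hpm hm4] at ha hb hab
  obtain ⟨a1, a2, a3, a4, a5, -⟩ := ha
  obtain ⟨b1, b2, b3, b4, b5, -⟩ := hb
  rw [Prod.fst_add, Prod.snd_add, ZMod.val_add] at hab
  obtain ⟨c1, c2, c3, c4, -, c6⟩ := hab
  have hcases := cases_of_add_mod_mem_Icc (by omega) ⟨a1, a2⟩ ⟨b1, b2⟩ (hpm ▸ ⟨c1, c2⟩)
  rw [← hpm] at hcases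
  rcases hcases with ⟨ha, hb, hr⟩ | ⟨ha, hb, hr⟩ | ⟨ha, hb, hr⟩ | ⟨ha, hb, hr⟩
  · exact c6 hr (by rw [a3 ha, b3 hb, add_zero])
  · exact b5 hb (by rw [← c4 hr, a3 ha, zero_add])
  · exact a5 ha (by rw [← c4 hr, b3 hb, add_zero])
  · exact ZMod.neg_one_add_neg_one_ne_zero (p := p) (by omega) (by rw [← c3 hr, a4 ha, b4 hb])

theorem ncard_nonNormalSumFreeSet {p m : ℕ} [Fact p.Prime] (hpm : p = 3 * m - 1) (hm4 : 4 ≤ m) :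
    (nonNormalSumFreeSet p m).ncard = (m - 1) * p := by
  have hcol (k : ℕ) (c : ZMod p) :
      {x : ZMod p × ZMod p | x.1 = (k : ZMod p) ∧ x.2 ≠ c}.ncard = p - 1 := by
    rw [show {x : ZMod p × ZMod p | x.1 = (k : ZMod p) ∧ x.2 ≠ c} =
      {(k : ZMod p)} ×ˢ {c}ᶜ by ext; simp, Set.ncard_prod, Set.ncard_compl]
    simp
  have hmid : {x : ZMod p × ZMod p | ∃ k : ℕ, m + 1 ≤ k ∧ k ≤ 2 * m - 3 ∧
      x.1 = (k : ZMod p)}.ncard = (m - 3) * p := by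
    rw [show {x : ZMod p × ZMod p | ∃ k : ℕ, m + 1 ≤ k ∧ k ≤ 2 * m - 3 ∧
        x.1 = (k : ZMod p)} =
      ((fun k : ℕ => (k : ZMod p)) '' Set.Icc (m + 1) (2 * m - 3)) ×ˢ Set.univ by
        ext; simp [and_assoc, eq_comm], Set.ncard_prod,
      ZMod.ncard_natCast_image_Icc (by omega), Set.ncard_univ, Nat.card_zmod]
    congr 1
    omega
  rw [nonNormalSumFreeSet, Set.ncard_union_eq, Set.ncard_union_eq, Set.ncard_union_eq,
    Set.ncard_pair, hcol, hcol, hmid]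
  · obtain ⟨n, rfl⟩ : ∃ n, m = n + 3 := ⟨m - 3, by omega⟩
    simp only [Nat.add_sub_cancel, show n + 3 - 1 = n + 2 by omega, add_mul]
    omega
  · rw [Ne, Prod.ext_iff, ZMod.eq_natCast_iff_val_eq (by omega),
      ZMod.val_cast_of_lt (by omega)]
    omega
  all_goals
    rw [Set.disjoint_left]
    intro x
    simp only [Set.mem_union, Set.mem_insert_iff, Set.mem_singleton_iff, Set.mem_ofPred_eq,
      Prod.ext_iff, ZMod.exists_natCast_eq_iff_val_mem (show 2 * m - 3 < p by omega)]
    repeat rw [ZMod.eq_natCast_iff_val_eq (by omega)]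
    omega

theorem not_nonNormalSumFreeSet_subset {p m : ℕ} [Fact p.Prime] (hpm : p = 3 * m - 1) (hm4 : 4 ≤ m)
    {V : Submodule (ZMod p) (ZMod p × ZMod p)} {w : ZMod p × ZMod p} (hw : w ∉ V) :
    ¬ nonNormalSumFreeSet p m ⊆
      {a | ∃ k : ℕ, m ≤ k ∧ k ≤ 2 * m - 1 ∧ a - (k : ZMod p) • w ∈ V} := by
  intro hsub
  obtain ⟨f, hfw, hfV⟩ := Submodule.exists_dual_map_eq_bot_of_notMem hw inferInstance
  let S : Set (ZMod p) := (fun k : ℕ => (k : ZMod p)) '' Set.Icc m (2 * m - 1)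
  have hS : S.ncard = m := by
    rw [ZMod.ncard_natCast_image_Icc (by omega)]
    omega
  have hfS (a : ZMod p × ZMod p) (ha : a ∈ nonNormalSumFreeSet p m) : f a * (f w)⁻¹ ∈ S := by
    obtain ⟨k, hk1, hk2, hk⟩ := hsub ha
    have h0 : f (a - (k : ZMod p) • w) = 0 := by
      have := Submodule.mem_map_of_mem (f := f) hk
      rwa [hfV, Submodule.mem_bot] at this
    rw [map_sub, map_smul, smul_eq_mul, sub_eq_zero] at h0
    refine ⟨k, ⟨hk1, hk2⟩, ?_⟩
    rw [h0, mul_inv_cancel_right₀ hfw]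
  have hf (x y : ZMod p) : f (x, y) = x * f (1, 0) + y * f (0, 1) := by
    rw [← smul_eq_mul, ← smul_eq_mul, ← map_smul, ← map_smul, ← map_add]
    simp
  have hval {k : ℕ} (hk : k ≤ 2 * m - 1) : (k : ZMod p).val = k :=
    ZMod.val_cast_of_lt (by omega)
  by_cases hβ : f (0, 1) = 0
  · have hα : f (1, 0) ≠ 0 := by
      intro hα
      apply hfw
      rw [← Prod.mk.eta (p := w), hf, hα, hβ]
      simp
    have hsubset : (fun x : ZMod p => x * (f (1, 0) * (f w)⁻¹)) ''
        ((fun k : ℕ => (k : ZMod p)) '' Set.Icc (m - 1) (2 * m - 1)) ⊆ S := by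
      rintro _ ⟨_, ⟨k, ⟨hk1, hk2⟩, rfl⟩, rfl⟩
      have hy : ∃ y : ZMod p, ((k : ZMod p), y) ∈ nonNormalSumFreeSet p m := by
        simp only [mem_nonNormalSumFreeSet_iff hpm hm4, hval hk2]
        by_cases hk : k = m - 1 ∨ k = m
        · exact ⟨0, by omega, by omega, by simp, by omega, by simp, by omega⟩
        · exact ⟨-1, by omega, by omega, by omega, by simp, by omega, by simp⟩
      obtain ⟨y, hy⟩ := hy
      have := hfS _ hy
      rwa [hf, hβ, mul_zero, add_zero, mul_assoc] at this
    have hle := Set.ncard_le_ncard hsubset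
    rw [Set.ncard_image_of_injective _
      (mul_left_injective₀ (mul_ne_zero hα (inv_ne_zero hfw))),
      ZMod.ncard_natCast_image_Icc (by omega), hS] at hle
    omega
  · have huniv : (Set.univ : Set (ZMod p)) ⊆ S := by
      intro t _
      have hmem : (((m + 1 : ℕ) : ZMod p),
          (t * f w - ((m + 1 : ℕ) : ZMod p) * f (1, 0)) * (f (0, 1))⁻¹) ∈
            nonNormalSumFreeSet p m := by
        rw [mem_nonNormalSumFreeSet_iff hpm hm4, hval (by omega)]
        omega
      have := hfS _ hmem
      rwa [hf, inv_mul_cancel_right₀ hβ, add_sub_cancel, mul_inv_cancel_right₀ hfw] at this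
    have hle := Set.ncard_le_ncard huniv
    rw [Set.ncard_univ, Nat.card_zmod, hS] at hle
    omega

theorem stmt_9 (p : ℕ) [Fact p.Prime] (hp : 11 ≤ p) (hp3 : p % 3 = 2)
    (m : ℕ) (hm : m = (p + 1) / 3)
    (A₂ : Set (ZMod p × ZMod p))
    (hA : A₂ = {(((m - 1 : ℕ) : ZMod p), (0 : ZMod p)),
                (((2 * m - 1 : ℕ) : ZMod p), (-1 : ZMod p))} ∪
          {x | x.1 = ((m : ℕ) : ZMod p) ∧ x.2 ≠ -1} ∪
          {x | x.1 = ((2 * m - 2 : ℕ) : ZMod p) ∧ x.2 ≠ 0} ∪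
          {x | ∃ k : ℕ, m + 1 ≤ k ∧ k ≤ 2 * m - 3 ∧ x.1 = (k : ZMod p)}) :
    (∀ a ∈ A₂, ∀ b ∈ A₂, a + b ∉ A₂) ∧ A₂.ncard = (m - 1) * p ∧
    ¬ ∃ V : Submodule (ZMod p) (ZMod p × ZMod p),
        Module.finrank (ZMod p) V = 1 ∧
        ∃ w : ZMod p × ZMod p, w ∉ V ∧
          A₂ ⊆ {a | ∃ k : ℕ, m ≤ k ∧ k ≤ 2 * m - 1 ∧
                  a - (k : ZMod p) • w ∈ V} := by
  have hpm : p = 3 * m - 1 := by omega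
  have hm4 : 4 ≤ m := by omega
  change A₂ = nonNormalSumFreeSet p m at hA
  subst hA
  refine ⟨add_notMem_nonNormalSumFreeSet hpm hm4, ncard_nonNormalSumFreeSet hpm hm4, ?_⟩
  rintro ⟨V, -, w, hw, hsub⟩
  exact not_nonNormalSumFreeSet_subset hpm hm4 hw hsub
end

section
/- Let p ≥ 11 be a prime with p ≡ 2 mod 3, n ∈ ℕ, and A ⊆ F_p^n sum-free with |A| ≥ (m_p − 1/2 + 1/p)·p^{n−1}, where m_p = (p+1)/3. Then A is normal: there exist a codimension-1 subspace V < F_p^n and w ∉ V such that A ⊆ {m_p·w, ..., (2m_p−1)·w} + V. -/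
open Pointwise

theorem winding_aux {p : ℕ} [Fact p.Prime] (σ E : ZMod p → ℤ) (j : ZMod p)
    (hσ : ∀ x y, 2 * |σ x - σ y| ≤ p - 2) (h0 : σ 0 = 0)
    (hE : ∀ k, (p : ℤ) ∣ σ (k + j) - σ k - σ j - E k) (hEs : ∑ k, |E k| ≤ (p : ℤ) - 2) :
    ¬ 0 < σ j := by
  intro ha
  choose w hw using hE
  have hshift : ∑ k, σ (k + j) = ∑ k, σ k :=
    Equiv.sum_comp (Equiv.addRight j) σ
  have hsum : -(p : ℤ) * σ j - ∑ k, E k = p * ∑ k, w k := by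
    rw [Finset.mul_sum, ← Finset.sum_congr rfl fun k _ => hw k]
    simp [Finset.sum_sub_distrib, hshift, ZMod.card]
  have hp := (Fact.out : p.Prime).two_le
  have habs : |∑ k, E k| ≤ (p : ℤ) - 2 := (Finset.abs_sum_le_sum_abs _ _).trans hEs
  have hE0 : ∑ k, E k = 0 := by
    apply Int.eq_zero_of_abs_lt_dvd (m := (p : ℤ)) ⟨-σ j - ∑ k, w k, by linarith⟩
    omega
  have hwsum : ∑ k, w k = -σ j := by
    have hp' : (p : ℤ) ≠ 0 := by positivity
    apply mul_left_cancel₀ hp'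
    linarith
  have ha2 : 2 * σ j ≤ p - 2 := by
    have := hσ j 0
    rw [h0, sub_zero, abs_of_pos ha] at this
    exact this
  have key : ∀ k, ((p : ℤ) + 2 - 2 * σ j) * (-w k) ≤ |E k| + E k := by
    intro k
    have h1 := hw k
    have h2 := hσ (k + j) k
    have h3 := neg_abs_le (σ (k + j) - σ k)
    have h4 := neg_abs_le (E k)
    have h5 := le_abs_self (E k)
    rcases le_or_gt 0 (w k) with h | h
    · nlinarith
    · nlinarith
  have := Finset.sum_le_sum fun k (_ : k ∈ Finset.univ) => key k
  rw [← Finset.mul_sum, Finset.sum_neg_distrib, Finset.sum_add_distrib, hwsum, hE0] at this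
  nlinarith

theorem two_mul_abs_sum_le {ι : Type*} [Fintype ι] [DecidableEq ι] (D : ι → ℤ)
    (h : ∑ k, D k = 0) (S : Finset ι) : 2 * |∑ k ∈ S, D k| ≤ ∑ k, |D k| := by
  have h1 := Finset.sum_add_sum_compl S D
  have h2 := Finset.sum_add_sum_compl S fun k => |D k|
  have h3 := Finset.abs_sum_le_sum_abs D S
  have h4 := Finset.abs_sum_le_sum_abs D Sᶜ
  have h5 : ∑ k ∈ Sᶜ, D k = -∑ k ∈ S, D k := by linarith
  rw [h5, abs_neg] at h4
  linarith

/-- A function on `ZMod p` with small total variation lifts to the integers. -/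
theorem exists_lift_of_sum_abs_le {p : ℕ} [Fact p.Prime] (s : ZMod p → ZMod p) (D : ZMod p → ℤ)
    (s0 : s 0 = 0) (hD : ∀ k, (D k : ZMod p) = s (k + 1) - s k)
    (hDs : ∑ k, |D k| ≤ (p : ℤ) - 2) :
    ∃ σ : ZMod p → ℤ, σ 0 = 0 ∧ (∀ k, (σ k : ZMod p) = s k) ∧
      ∀ x y, 2 * |σ x - σ y| ≤ p - 2 := by
  have hD0 : ∑ k, D k = 0 := by
    have habs : |∑ k, D k| ≤ (p : ℤ) - 2 := (Finset.abs_sum_le_sum_abs _ _).trans hDs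
    apply Int.eq_zero_of_abs_lt_dvd (m := (p : ℤ)) _ (by omega)
    rw [← ZMod.intCast_zmod_eq_zero_iff_dvd]
    push_cast
    rw [Finset.sum_congr rfl fun k _ => hD k, Finset.sum_sub_distrib, sub_eq_zero]
    exact Equiv.sum_comp (Equiv.addRight (1 : ZMod p)) s
  refine ⟨fun k => ∑ l with l.val < k.val, D l, by simp, ?_, ?_⟩
  · have key : ∀ n : ℕ, n < p → ((∑ l : ZMod p with l.val < n, D l : ℤ) : ZMod p) = s n := by
      intro n
      induction n with
      | zero => intro _; simp [s0]
      | succ n ih =>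
        intro hn
        have : (Finset.univ.filter fun l : ZMod p => l.val < n + 1) =
            insert (n : ZMod p) (Finset.univ.filter fun l : ZMod p => l.val < n) := by
          ext l
          simp only [Finset.mem_filter, Finset.mem_univ, true_and, Finset.mem_insert,
            Nat.lt_succ_iff_lt_or_eq]
          rw [or_comm]
          refine or_congr ⟨fun h => ?_, fun h => ?_⟩ Iff.rfl
          · rw [← h, ZMod.natCast_zmod_val]
          · rw [h, ZMod.val_natCast_of_lt (by omega)]
        rw [this, Finset.sum_insert, Int.cast_add, ih (by omega), hD]
        · push_cast; ring
        · simp [ZMod.val_natCast_of_lt (show n < p by omega)]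
    intro k
    rw [key _ (ZMod.val_lt k), ZMod.natCast_zmod_val]
  · have key : ∀ x y : ZMod p, y.val ≤ x.val →
        2 * |∑ l with l.val < x.val, D l - ∑ l with l.val < y.val, D l| ≤ (p : ℤ) - 2 := by
      intro x y hxy
      rw [← Finset.sum_sdiff_eq_sub]
      · exact (two_mul_abs_sum_le D hD0 _).trans hDs
      · intro l; simp; omega
    intro x y
    rcases le_total y.val x.val with h | h
    · exact key x y h
    · rw [abs_sub_comm]; exact key y x h

theorem eq_zero_of_winding {p : ℕ} [Fact p.Prime] (s : ZMod p → ZMod p) (D E : ZMod p → ℤ)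
    (j : ZMod p) (s0 : s 0 = 0) (hD : ∀ k, (D k : ZMod p) = s (k + 1) - s k)
    (hE : ∀ k, (E k : ZMod p) = s (k + j) - s k - s j)
    (hDs : ∑ k, |D k| ≤ (p : ℤ) - 2) (hEs : ∑ k, |E k| ≤ (p : ℤ) - 2) : s j = 0 := by
  obtain ⟨σ, hσ0, hσs, hσ⟩ := exists_lift_of_sum_abs_le s D s0 hD hDs
  have h1 : ∀ k, (p : ℤ) ∣ σ (k + j) - σ k - σ j - E k := by
    intro k
    rw [← ZMod.intCast_zmod_eq_zero_iff_dvd]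
    push_cast
    rw [hσs, hσs, hσs, hE, sub_self]
  have h2 : ¬ 0 < σ j := winding_aux σ E j hσ hσ0 h1 hEs
  have h3 : ¬ 0 < (-σ) j := by
    apply winding_aux (-σ) (-E) j _ (by simp [hσ0]) _ (by simpa using hEs)
    · intro x y
      have := hσ y x
      simpa [abs_sub_comm, sub_eq_add_neg, add_comm] using this
    · intro k
      have : (-σ) (k + j) - (-σ) k - (-σ) j - (-E) k = -(σ (k + j) - σ k - σ j - E k) := by
        simp only [Pi.neg_apply]; ring
      rw [this, dvd_neg]
      exact h1 k
  have h4 : σ j = 0 := by simp at h3; omega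
  rw [← hσs, h4, Int.cast_zero]

/-- The residues `m, m + 1, …, 2 * m - 1` modulo `p`. -/
def middleArc (p m : ℕ) : Finset (ZMod p) :=
  (Finset.Ico m (2 * m)).image (fun k : ℕ => (k : ZMod p))

section middleArc

variable {p m : ℕ}

theorem mem_middleArc {t : ZMod p} :
    t ∈ middleArc p m ↔ ∃ k : ℕ, m ≤ k ∧ k < 2 * m ∧ (k : ZMod p) = t := by
  simp [middleArc, and_assoc]

theorem int_eq_of_cast_eq {a b : ℤ} (h : (a : ZMod p) = b) (hab : |a - b| < p) : a = b := by
  rw [← sub_eq_zero]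
  apply Int.eq_zero_of_abs_lt_dvd _ hab
  rw [← ZMod.intCast_zmod_eq_zero_iff_dvd]
  simp [h]

theorem card_middleArc (hpm : p + 1 = 3 * m) : (middleArc p m).card = m := by
  rw [middleArc, Finset.card_image_of_injOn]
  · simp; omega
  · intro a ha b hb hab
    simp only [Finset.coe_Ico, Set.mem_Ico] at ha hb
    have := int_eq_of_cast_eq (p := p) (a := a) (b := b) (by simpa using hab)
      (by rw [abs_lt]; constructor <;> omega)
    exact_mod_cast this

theorem notMem_middleArc_iff (hpm : p + 1 = 3 * m) (hm : 2 ≤ m) {t : ZMod p} :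
    t ∉ middleArc p m ↔ ∃ i : ℤ, |i| < m ∧ (i : ZMod p) = t := by
  have : NeZero p := ⟨by omega⟩
  constructor
  · intro h
    by_cases h1 : t.val < m
    · exact ⟨t.val, by rw [abs_lt]; constructor <;> omega, by simp⟩
    · by_cases h2 : t.val < 2 * m
      · exact absurd (mem_middleArc.2 ⟨t.val, by omega, h2, by simp⟩) h
      · refine ⟨(t.val : ℤ) - p, ?_, by simp⟩
        have := t.val_lt
        rw [abs_lt]; constructor <;> omega
  · rintro ⟨i, hi, rfl⟩ h
    obtain ⟨k, hk1, hk2, hk⟩ := mem_middleArc.1 h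
    rw [abs_lt] at hi
    have := int_eq_of_cast_eq (p := p) (a := k) (b := i) (by simpa using hk)
      (by rw [abs_lt]; constructor <;> omega)
    omega

theorem sub_notMem_middleArc (hpm : p + 1 = 3 * m) (hm : 2 ≤ m) {a b : ZMod p}
    (ha : a ∈ middleArc p m) (hb : b ∈ middleArc p m) : a - b ∉ middleArc p m := by
  obtain ⟨k, hk1, hk2, rfl⟩ := mem_middleArc.1 ha
  obtain ⟨l, hl1, hl2, rfl⟩ := mem_middleArc.1 hb
  rw [notMem_middleArc_iff hpm hm]
  exact ⟨k - l, by rw [abs_lt]; constructor <;> omega, by push_cast; rfl⟩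

theorem neg_mem_middleArc (hpm : p + 1 = 3 * m) (hm : 2 ≤ m) {a : ZMod p}
    (ha : a ∈ middleArc p m) : -a ∈ middleArc p m := by
  by_contra h
  obtain ⟨i, hi, h⟩ := (notMem_middleArc_iff hpm hm).1 h
  refine (notMem_middleArc_iff hpm hm).2 ⟨-i, by simpa using hi, ?_⟩ ha
  simp [h]

theorem exists_sub_mem_middleArc (hpm : p + 1 = 3 * m) (hm : 2 ≤ m) (C : Finset (ZMod p))
    (hC : ∀ a ∈ C, ∀ b ∈ C, a - b ∉ middleArc p m) :
    ∃ t, ∀ c ∈ C, c - t ∈ middleArc p m := by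
  rcases C.eq_empty_or_nonempty with rfl | ⟨b, hb⟩
  · simp
  have h1 : ∀ c : C, ∃ i : ℤ, |i| < m ∧ (i : ZMod p) = c - b := fun c =>
    (notMem_middleArc_iff hpm hm).1 (hC c c.2 b hb)
  choose i hi hic using h1
  have : Nonempty C := ⟨⟨b, hb⟩⟩
  obtain ⟨c₁, hc₁⟩ := Finite.exists_min i
  refine ⟨c₁ - m, fun c hc => ?_⟩
  obtain ⟨k, hk, hkc⟩ := (notMem_middleArc_iff hpm hm).1 (hC c hc c₁ c₁.2)
  have h2 := hc₁ ⟨c, hc⟩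
  have h3 := hi ⟨c, hc⟩
  have h4 := hi c₁
  rw [abs_lt] at h3 h4 hk
  have h5 : i ⟨c, hc⟩ - i c₁ = k := by
    apply int_eq_of_cast_eq (p := p)
    · push_cast
      rw [hic, hic, hkc]
      ring
    · rw [abs_lt]; constructor <;> omega
  refine mem_middleArc.2 ⟨m + k.toNat, by omega, by omega, ?_⟩
  have h6 : ((k.toNat : ℤ) : ZMod p) = k := by rw [Int.toNat_of_nonneg (by omega)]
  push_cast at h6 ⊢
  rw [h6, hkc]
  ring

theorem card_le_of_shift (hpm : p + 1 = 3 * m) (C : Finset (ZMod p)) {t : ZMod p}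
    {i : ℕ} (hi : i < m) (h1 : ∀ c ∈ C, c - t ∈ middleArc p m)
    (h2 : ∀ c ∈ C, c - (t - i) ∈ middleArc p m) : C.card + i ≤ m := by
  have : C ⊆ (Finset.Ico m (2 * m - i)).image (fun k : ℕ => t + (k : ZMod p)) := by
    intro c hc
    obtain ⟨k, hk1, hk2, hk⟩ := mem_middleArc.1 (h1 c hc)
    obtain ⟨l, hl1, hl2, hl⟩ := mem_middleArc.1 (h2 c hc)
    have : (l : ℤ) = k + i := by
      apply int_eq_of_cast_eq (p := p)
      · push_cast; rw [hk, hl]; ring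
      · rw [abs_lt]; constructor <;> omega
    exact Finset.mem_image.2 ⟨k, by simp; omega, by rw [hk]; ring⟩
  have := (Finset.card_le_card this).trans Finset.card_image_le
  simp at this
  omega

theorem exists_int_sub_eq (hpm : p + 1 = 3 * m) (hm : 2 ≤ m) (C : Finset (ZMod p))
    (hC : C.Nonempty) {t t' : ZMod p} (h1 : ∀ c ∈ C, c - t ∈ middleArc p m)
    (h2 : ∀ c ∈ C, c - t' ∈ middleArc p m) :
    ∃ i : ℤ, |i| + C.card ≤ m ∧ (i : ZMod p) = t - t' := by
  obtain ⟨c, hc⟩ := hC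
  obtain ⟨i, hi, hi'⟩ := (notMem_middleArc_iff hpm hm).1
    (sub_notMem_middleArc hpm hm (h2 c hc) (h1 c hc))
  have hi' : (i : ZMod p) = t - t' := by rw [hi']; ring
  refine ⟨i, ?_, hi'⟩
  rcases abs_cases i with ⟨h, h0⟩ | ⟨h, h0⟩
  · have := card_le_of_shift hpm C (t := t) (i := i.toNat) (by omega) h1 (by
      have h6 : ((i.toNat : ℤ) : ZMod p) = i := by rw [Int.toNat_of_nonneg (by omega)]
      rw [Int.cast_natCast] at h6
      rw [h6, hi', sub_sub_cancel]
      exact h2)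
    omega
  · have := card_le_of_shift hpm C (t := t') (i := (-i).toNat) (by omega) h2 (by
      have h6 : (((-i).toNat : ℤ) : ZMod p) = (-i : ℤ) := by
        rw [Int.toNat_of_nonneg (by omega)]
      rw [Int.cast_natCast, Int.cast_neg] at h6
      rw [h6, hi', neg_sub, sub_sub_cancel]
      exact h1)
    omega

end middleArc

section Progressions

variable {p : ℕ} [Fact p.Prime]

theorem eq_univ_of_add_mem {S : Finset (ZMod p)} (hS : S.Nonempty) {r : ZMod p} (hr : r ≠ 0)
    (h : ∀ s ∈ S, s + r ∈ S) : S = Finset.univ := by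
  obtain ⟨s, hs⟩ := hS
  have key : ∀ n : ℕ, s + n * r ∈ S := by
    intro n
    induction n with
    | zero => simpa using hs
    | succ n ih => convert h _ ih using 1; push_cast; ring
  refine Finset.eq_univ_of_forall fun x => ?_
  convert key ((x - s) / r).val using 1
  rw [ZMod.natCast_zmod_val, div_mul_cancel₀ _ hr]
  ring

/-- A finite set of residues is a progression if it consists of finitely many consecutive
multiples of a nonzero residue, up to a translation. -/
def IsProgression (S : Finset (ZMod p)) : Prop :=
  ∃ a r : ZMod p, r ≠ 0 ∧ ∃ l : ℕ, S = (Finset.range l).image fun i : ℕ => a + i * r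

theorem exists_eq_image_of_card_add_pair_le {A : Finset (ZMod p)} (hA : A.Nonempty)
    (hA' : A ≠ Finset.univ) {b r : ZMod p} (hr : r ≠ 0)
    (h : (A + {b, b + r}).card ≤ A.card + 1) :
    ∃ a : ZMod p, ∃ l : ℕ, A = (Finset.range l).image fun i : ℕ => a + i * r := by
  have huniq : ∀ x ∈ A, ∀ y ∈ A, x + r ∉ A → y + r ∉ A → x = y := by
    intro x hx y hy hx' hy'
    by_contra hxy
    have hsub : (insert (x + r) (insert (y + r) A)).image (· + b) ⊆ A + {b, b + r} := by
      intro z hz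
      obtain ⟨w, hw, rfl⟩ := Finset.mem_image.1 hz
      rw [Finset.mem_insert, Finset.mem_insert] at hw
      rw [Finset.mem_add]
      rcases hw with rfl | rfl | hw
      · exact ⟨x, hx, b + r, by simp, by ring⟩
      · exact ⟨y, hy, b + r, by simp, by ring⟩
      · exact ⟨w, hw, b, by simp, rfl⟩
    have h1 := Finset.card_le_card hsub
    rw [Finset.card_image_of_injective _ (add_left_injective b), Finset.card_insert_of_notMem,
      Finset.card_insert_of_notMem hy'] at h1
    · omega
    · rw [Finset.mem_insert, not_or]
      exact ⟨fun h => hxy (add_right_cancel h), hx'⟩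
  have hstart : ∃ a ∈ A, a - r ∉ A := by
    by_contra! hcon
    exact hA' (eq_univ_of_add_mem hA (neg_ne_zero.2 hr) fun s hs => by
      rw [← sub_eq_add_neg]; exact hcon s hs)
  obtain ⟨a, ha, har⟩ := hstart
  have hleave : ∃ l : ℕ, a + l * r ∉ A := by
    by_contra! hcon
    apply hA'
    refine Finset.eq_univ_of_forall fun x => ?_
    convert hcon ((x - a) / r).val using 1
    rw [ZMod.natCast_zmod_val, div_mul_cancel₀ _ hr]
    ring
  classical
  obtain ⟨l, hl, hmin⟩ : ∃ l : ℕ, a + l * r ∉ A ∧ ∀ i < l, a + i * r ∈ A :=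
    ⟨Nat.find hleave, Nat.find_spec hleave, fun i hi => not_not.1 (Nat.find_min hleave hi)⟩
  have hl0 : l ≠ 0 := by rintro rfl; simp [ha] at hl
  refine ⟨a, l, ?_⟩
  set R := (Finset.range l).image fun i : ℕ => a + i * r with hR
  have hRA : R ⊆ A := by
    intro x hx
    obtain ⟨i, hi, rfl⟩ := Finset.mem_image.1 hx
    exact hmin i (Finset.mem_range.1 hi)
  refine (Finset.Subset.antisymm ?_ hRA)
  by_contra hcon
  have hne : (A \ R).Nonempty := Finset.sdiff_nonempty.2 hcon
  have hun := eq_univ_of_add_mem hne hr (by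
    intro s hs
    obtain ⟨hsA, hsR⟩ := Finset.mem_sdiff.1 hs
    have hsr : s + r ∈ A := by
      by_contra hsr
      have hlast : a + (l - 1 : ℕ) * r ∈ A := hmin _ (by omega)
      have hlast' : a + (l - 1 : ℕ) * r + r ∉ A := by
        convert hl using 2
        rw [Nat.cast_sub (by omega)]
        push_cast
        ring
      apply hsR
      rw [huniq s hsA _ hlast hsr hlast']
      exact Finset.mem_image.2 ⟨l - 1, Finset.mem_range.2 (by omega), rfl⟩
    refine Finset.mem_sdiff.2 ⟨hsr, fun hsR' => ?_⟩
    obtain ⟨i, hi, his⟩ := Finset.mem_image.1 hsR'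
    have hi := Finset.mem_range.1 hi
    rcases Nat.eq_zero_or_pos i with rfl | h0
    · apply har
      convert hsA using 1
      simp only [Nat.cast_zero, zero_mul, add_zero] at his
      linear_combination his
    · apply hsR
      refine Finset.mem_image.2 ⟨i - 1, Finset.mem_range.2 (by omega), ?_⟩
      rw [Nat.cast_sub (by omega)]
      push_cast
      linear_combination his)
  have : a ∈ A \ R := by rw [hun]; exact Finset.mem_univ _
  refine (Finset.mem_sdiff.1 this).2 (Finset.mem_image.2 ⟨0, Finset.mem_range.2 (by omega), ?_⟩)
  simp

theorem isProgression_add_pair {A : Finset (ZMod p)} (hA : A.Nonempty)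
    (hA' : A ≠ Finset.univ) {b r : ZMod p} (hr : r ≠ 0)
    (h : (A + {b, b + r}).card ≤ A.card + 1) : IsProgression (A + {b, b + r}) := by
  obtain ⟨a, l, hl⟩ := exists_eq_image_of_card_add_pair_le hA hA' hr h
  have hl0 : l ≠ 0 := by rintro rfl; simp [hl] at hA
  refine ⟨a + b, r, hr, l + 1, ?_⟩
  ext x
  simp only [Finset.mem_add, hl, Finset.mem_image, Finset.mem_range, Finset.mem_insert,
    Finset.mem_singleton]
  constructor
  · rintro ⟨_, ⟨i, hi, rfl⟩, c, rfl | rfl, rfl⟩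
    · exact ⟨i, by omega, by ring⟩
    · exact ⟨i + 1, by omega, by push_cast; ring⟩
  · rintro ⟨i, hi, rfl⟩
    rcases Nat.lt_or_ge i l with h | h
    · exact ⟨_, ⟨i, h, rfl⟩, b, Or.inl rfl, by ring⟩
    · refine ⟨_, ⟨i - 1, by omega, rfl⟩, b + r, Or.inr rfl, ?_⟩
      rw [Nat.cast_sub (by omega)]
      push_cast; ring

/-- The critical case of the Cauchy-Davenport inequality: the sumset is a progression. -/
theorem isProgression_add : ∀ (n : ℕ) (A B : Finset (ZMod p)), B.card = n → 2 ≤ A.card →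
    2 ≤ B.card → (A + B).card + 1 = A.card + B.card → (A + B).card + 2 ≤ p →
    IsProgression (A + B) := by
  intro n
  induction n using Nat.strong_induction_on with
  | _ n ih =>
  intro A B hn hA2 hB2 hAB hABp
  have hA : A.Nonempty := Finset.card_pos.1 (by omega)
  have hB : B.Nonempty := Finset.card_pos.1 (by omega)
  have hprime : p.Prime := Fact.out
  have hA' : A ≠ Finset.univ := by
    rintro rfl
    rw [Finset.card_univ, ZMod.card] at hAB
    omega
  rcases Nat.lt_or_ge B.card 3 with h3 | h3
  · obtain ⟨b, b', hbb, rfl⟩ := Finset.card_eq_two.1 (show B.card = 2 by omega)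
    have := isProgression_add_pair hA hA' (b := b) (sub_ne_zero.2 hbb.symm)
    rw [add_sub_cancel] at this
    exact this (by omega)
  classical
  set E := A - B with hE
  have hEcard : A.card + B.card - 1 ≤ E.card := by
    have := ZMod.cauchy_davenport hprime hA (t := -B) (by simpa using hB)
    rw [Finset.card_neg, ← sub_eq_add_neg, ← hE] at this
    omega
  set E₁ := E.filter fun e => ∀ b ∈ B, b + e ∈ A with hE₁
  have hE₁card : E₁.card + B.card ≤ A.card + 1 ∨ E₁.card = 0 := by
    rcases E₁.eq_empty_or_nonempty with h | h
    · right; simp [h]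
    left
    have h1 := ZMod.cauchy_davenport hprime h hB
    have h2 : E₁ + B ⊆ A := by
      intro x hx
      obtain ⟨e, he, b, hb, rfl⟩ := Finset.mem_add.1 hx
      rw [add_comm]
      exact (Finset.mem_filter.1 he).2 b hb
    have := Finset.card_le_card h2
    omega
  have hbig : B.card < (E \ E₁).card := by
    have := Finset.le_card_sdiff E₁ E
    omega
  let Be : ZMod p → Finset (ZMod p) := fun e => B.filter fun b => b + e ∈ A
  let Ae : ZMod p → Finset (ZMod p) := fun e => A ∪ B.image (· + e)
  have hcards : ∀ e, (Ae e).card + (Be e).card = A.card + B.card := by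
    intro e
    have h1 := Finset.card_union_add_card_inter A (B.image (· + e))
    have h2 : A ∩ B.image (· + e) = (Be e).image (· + e) := by
      ext x
      simp only [Be, Finset.mem_inter, Finset.mem_image, Finset.mem_filter]
      constructor
      · rintro ⟨hx, b, hb, rfl⟩; exact ⟨b, ⟨hb, hx⟩, rfl⟩
      · rintro ⟨b, ⟨hb, hx⟩, rfl⟩; exact ⟨hx, b, hb, rfl⟩
    rw [h2, Finset.card_image_of_injective _ (add_left_injective e),
      Finset.card_image_of_injective _ (add_left_injective e)] at h1
    exact h1
  have hsub : ∀ e, Ae e + Be e ⊆ A + B := by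
    intro e x hx
    obtain ⟨a, ha, b, hb, rfl⟩ := Finset.mem_add.1 hx
    obtain ⟨hb, hbe⟩ := Finset.mem_filter.1 hb
    rcases Finset.mem_union.1 ha with ha | ha
    · exact Finset.add_mem_add ha hb
    · obtain ⟨c, hc, rfl⟩ := Finset.mem_image.1 ha
      exact Finset.mem_add.2 ⟨b + e, hbe, c, hc, by ring⟩
  have hBe : ∀ e ∈ E, (Be e).Nonempty := by
    intro e he
    obtain ⟨a, ha, b, hb, rfl⟩ := Finset.mem_sub.1 he
    exact ⟨b, Finset.mem_filter.2 ⟨hb, by simpa using ha⟩⟩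
  have heq : ∀ e ∈ E, Ae e + Be e = A + B := by
    intro e he
    apply Finset.eq_of_subset_of_card_le (hsub e)
    have h1 := ZMod.cauchy_davenport hprime (s := Ae e) (hA.mono Finset.subset_union_left)
      (hBe e he)
    have := hcards e
    omega
  by_cases hex : ∃ e ∈ E \ E₁, 2 ≤ (Be e).card
  · obtain ⟨e, he, he2⟩ := hex
    obtain ⟨heE, heE₁⟩ := Finset.mem_sdiff.1 he
    have hlt : (Be e).card < B.card := by
      apply Finset.card_lt_card
      refine (Finset.filter_ssubset).2 ?_
      by_contra! hcon
      exact heE₁ (Finset.mem_filter.2 ⟨heE, hcon⟩)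
    have h1 := hcards e
    have h2 := heq e heE
    have h3 := ih _ (by omega) (Ae e) (Be e) rfl (by omega) he2 (by rw [h2]; omega)
      (by rw [h2]; omega)
    rwa [h2] at h3
  · push Not at hex
    have hone : ∀ e ∈ E \ E₁, ∃ b, Be e = {b} := by
      intro e he
      have h1 := hex e he
      have h2 := (hBe e (Finset.mem_sdiff.1 he).1).card_pos
      exact Finset.card_eq_one.1 (by omega)
    choose! β hβ using hone
    have hmem : ∀ e ∈ E \ E₁, β e ∈ B := by
      intro e he
      have : β e ∈ Be e := by rw [hβ e he]; simp
      exact (Finset.mem_filter.1 this).1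
    obtain ⟨e, he, e', he', hne, hee⟩ :=
      Finset.exists_ne_map_eq_of_card_lt_of_maps_to hbig hmem
    have h1 := heq e (Finset.mem_sdiff.1 he).1
    have h2 := heq e' (Finset.mem_sdiff.1 he').1
    rw [hβ e he] at h1
    rw [hβ e' he', ← hee] at h2
    have h3 : Ae e = Ae e' := by
      have := h1.trans h2.symm
      rw [Finset.add_singleton, Finset.add_singleton] at this
      exact Finset.image_injective (add_left_injective (β e)) this
    exfalso
    have hD : B.erase (β e) = Finset.univ := by
      apply eq_univ_of_add_mem _ (sub_ne_zero.2 hne)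
      · intro s hs
        obtain ⟨hsb, hsB⟩ := Finset.mem_erase.1 hs
        have hsA : s + e ∉ A := by
          intro h
          have : s ∈ Be e := Finset.mem_filter.2 ⟨hsB, h⟩
          rw [hβ e he, Finset.mem_singleton] at this
          exact hsb this
        have h4 : s + e ∈ Ae e' := by
          rw [← h3]
          exact Finset.mem_union_right _ (Finset.mem_image_of_mem _ hsB)
        rcases Finset.mem_union.1 h4 with h4 | h4
        · exact absurd h4 hsA
        obtain ⟨y, hy, hye⟩ := Finset.mem_image.1 h4
        have hsy : s + (e - e') = y := by linear_combination -hye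
        rw [hsy]
        refine Finset.mem_erase.2 ⟨?_, hy⟩
        rintro rfl
        have : β e ∈ Be e' := by rw [hβ e' he', hee]; simp
        have := (Finset.mem_filter.1 this).2
        rw [hye] at this
        exact hsA this
      · apply Finset.card_pos.1
        rw [Finset.card_erase_of_mem (hmem e he)]
        omega
    have : β e ∈ B.erase (β e) := by rw [hD]; exact Finset.mem_univ _
    simp at this

end Progressions

section Kneser

variable {p : ℕ} [Fact p.Prime] {U : Type*} [AddCommGroup U] [Module (ZMod p) U]

theorem mul_natCard_le_of_ne_top [Finite U] {W : Submodule (ZMod p) U} (hW : W ≠ ⊤) :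
    p * Nat.card W ≤ Nat.card U := by
  rw [Submodule.card_eq_card_quotient_mul_card W, mul_comm]
  apply Nat.mul_le_mul_left
  have : Nontrivial (U ⧸ W) := Submodule.Quotient.nontrivial_iff.2 hW
  rw [Module.natCard_eq_pow_finrank (K := ZMod p) (V := U ⧸ W), Nat.card_zmod]
  exact Nat.le_self_pow Module.finrank_pos.ne' p

theorem add_mem_of_mem_span {A : Set U} {S : Set U} (h : ∀ s ∈ S, ∀ a ∈ A, a + s ∈ A) {w : U}
    (hw : w ∈ Submodule.span (ZMod p) S) : ∀ a ∈ A, a + w ∈ A := by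
  induction hw using Submodule.span_induction with
  | mem x hx => exact h x hx
  | zero => intro a ha; simpa using ha
  | add x y _ _ hx hy => intro a ha; rw [← add_assoc]; exact hy _ (hx _ ha)
  | smul c x _ hx =>
    have key : ∀ n : ℕ, ∀ a ∈ A, a + n • x ∈ A := by
      intro n
      induction n with
      | zero => intro a ha; simpa using ha
      | succ n ih => intro a ha; rw [succ_nsmul, ← add_assoc]; exact hx _ (ih a ha)
    intro a ha
    have := key c.val a ha
    rwa [← Nat.cast_smul_eq_nsmul (ZMod p), ZMod.natCast_zmod_val] at this

/-- A weak form of Kneser's theorem in a vector space over a prime field. -/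
theorem add_eq_univ_or_card_le [DecidableEq U] [Fintype U] : ∀ (n : ℕ) (A B : Finset U),
    B.card = n → A.Nonempty → B.Nonempty →
    A + B = Finset.univ ∨ p * (A.card + B.card) ≤ p * (A + B).card + Nat.card U := by
  intro n
  induction n using Nat.strong_induction_on with
  | _ n ih =>
  intro A B hn hA hB
  by_cases hex : ∃ a ∈ A, ∃ b ∈ B, ∃ c ∈ B, c + (a - b) ∉ A
  · obtain ⟨a, ha, b, hb, c, hc, hcA⟩ := hex
    set e := a - b with he
    set Be := B.filter fun b => b + e ∈ A with hBe
    set Ae := A ∪ B.image (· + e) with hAe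
    have hcards : Ae.card + Be.card = A.card + B.card := by
      have h1 := Finset.card_union_add_card_inter A (B.image (· + e))
      have h2 : A ∩ B.image (· + e) = Be.image (· + e) := by
        ext x
        simp only [hBe, Finset.mem_inter, Finset.mem_image, Finset.mem_filter]
        constructor
        · rintro ⟨hx, b, hb, rfl⟩; exact ⟨b, ⟨hb, hx⟩, rfl⟩
        · rintro ⟨b, ⟨hb, hx⟩, rfl⟩; exact ⟨hx, b, hb, rfl⟩
      rw [h2, Finset.card_image_of_injective _ (add_left_injective e),
        Finset.card_image_of_injective _ (add_left_injective e)] at h1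
      exact h1
    have hsub : Ae + Be ⊆ A + B := by
      intro x hx
      obtain ⟨a, ha, b, hb, rfl⟩ := Finset.mem_add.1 hx
      obtain ⟨hb, hbe⟩ := Finset.mem_filter.1 hb
      rcases Finset.mem_union.1 ha with ha | ha
      · exact Finset.add_mem_add ha hb
      · obtain ⟨c, hc, rfl⟩ := Finset.mem_image.1 ha
        exact Finset.mem_add.2 ⟨b + e, hbe, c, hc, by abel⟩
    have hlt : Be.card < B.card :=
      Finset.card_lt_card (Finset.filter_ssubset.2 ⟨c, hc, hcA⟩)
    have hne : Be.Nonempty := ⟨b, Finset.mem_filter.2 ⟨hb, by simpa [he] using ha⟩⟩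
    rcases ih _ (by omega) Ae Be rfl (hA.mono Finset.subset_union_left) hne with h | h
    · left
      rw [h] at hsub
      exact Finset.univ_subset_iff.1 hsub
    · right
      rw [hcards] at h
      exact h.trans (Nat.add_le_add_right (Nat.mul_le_mul_left _ (Finset.card_le_card hsub)) _)
  · push Not at hex
    obtain ⟨b, hb⟩ := hB
    let W := Submodule.span (ZMod p) ((· - b) '' (B : Set U))
    have hinv : ∀ w ∈ W, ∀ a ∈ A, a + w ∈ A := by
      intro w hw
      apply add_mem_of_mem_span (A := (A : Set U)) _ hw
      rintro _ ⟨c, hc, rfl⟩ a ha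
      have := hex a ha b hb c hc
      rw [Finset.mem_coe]
      convert this using 1
      dsimp only
      abel
    by_cases hW : W = ⊤
    · left
      obtain ⟨a, ha⟩ := hA
      refine Finset.eq_univ_of_forall fun x => ?_
      refine Finset.mem_add.2 ⟨x - b, ?_, b, hb, sub_add_cancel _ _⟩
      have := hinv (x - b - a) (by rw [hW]; trivial) a ha
      rwa [add_sub_cancel] at this
    · right
      have h1 : B.card ≤ Nat.card W := by
        rw [← Nat.card_eq_finsetCard B]
        refine Nat.card_le_card_of_injective
          (fun c : B => (⟨c - b, Submodule.subset_span ⟨c, c.2, rfl⟩⟩ : W)) ?_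
        intro c c' h
        exact Subtype.ext (sub_left_injective (congrArg Subtype.val h))
      have h2 := mul_natCard_le_of_ne_top hW
      have h3 : A.card ≤ (A + B).card := Finset.card_le_card_add_right ⟨b, hb⟩
      have h4 := Nat.mul_le_mul_left p h1
      have h5 := Nat.mul_le_mul_left p h3
      rw [mul_add]
      omega

end Kneser

/-- Abstract data attached to the fibres of a sum-free set: `d z` is the defect of the fibre over
`z`, and `T z` is the set of translates of the middle arc that contain it. -/
structure ArcSystem (p m : ℕ) {V : Type*} [AddCommGroup V] (d : V → ℕ)
    (T : V → Set (ZMod p)) : Prop where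
  defect_zero : d 0 = 0
  zero_mem : 0 ∈ T 0
  nonempty : ∀ z, (T z).Nonempty
  close : ∀ z, d z < m → ∀ t ∈ T z, ∀ t' ∈ T z, ∃ i : ℤ, |i| ≤ d z ∧ (i : ZMod p) = t - t'
  add : ∀ x, d x = 0 → ∀ g ∈ T x, ∀ z, ∃ t ∈ T z, t + g ∈ T (x + z)

namespace ArcSystem

variable {p m : ℕ} {V : Type*} [AddCommGroup V] {d : V → ℕ} {T : V → Set (ZMod p)}

theorem eq_of_mem (h : ArcSystem p m d T) (hm : 0 < m) {x : V} (hx : d x = 0) {t t' : ZMod p}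
    (ht : t ∈ T x) (ht' : t' ∈ T x) : t = t' := by
  obtain ⟨i, hi, hi'⟩ := h.close x (by omega) t ht t' ht'
  rw [hx, Nat.cast_zero, abs_nonpos_iff] at hi
  rw [hi, Int.cast_zero] at hi'
  exact sub_eq_zero.1 hi'.symm

theorem add_mem (h : ArcSystem p m d T) (hm : 0 < m) {x y : V} (hx : d x = 0) (hy : d y = 0)
    {s t : ZMod p} (hs : s ∈ T x) (ht : t ∈ T y) : s + t ∈ T (x + y) := by
  obtain ⟨t', ht', h'⟩ := h.add x hx s hs y
  rwa [h.eq_of_mem hm hy ht ht', add_comm s]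

theorem shear [Module (ZMod p) V] (h : ArcSystem p m d T) (f : V →ₗ[ZMod p] ZMod p) :
    ArcSystem p m d (fun z => {t | t + f z ∈ T z}) where
  defect_zero := h.defect_zero
  zero_mem := by simpa using h.zero_mem
  nonempty z := by
    obtain ⟨t, ht⟩ := h.nonempty z
    exact ⟨t - f z, by simpa using ht⟩
  close z hz t ht t' ht' := by
    obtain ⟨i, hi, hi'⟩ := h.close z hz _ ht _ ht'
    exact ⟨i, hi, by rw [hi']; ring⟩
  add x hx g hg z := by
    obtain ⟨t, ht, ht'⟩ := h.add x hx _ hg z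
    refine ⟨t - f z, by simpa using ht, ?_⟩
    rw [Set.mem_ofPred_eq, map_add]
    convert ht' using 1
    ring

theorem restrict [Module (ZMod p) V] (h : ArcSystem p m d T) (U : Submodule (ZMod p) V) :
    ArcSystem p m (fun u : U => d u) (fun u : U => T u) where
  defect_zero := h.defect_zero
  zero_mem := h.zero_mem
  nonempty z := h.nonempty z
  close z hz := h.close z hz
  add x hx g hg z := h.add x hx g hg z

end ArcSystem

theorem exists_forall_apply_mem {V : Type*} [Fintype V] {X : Finset V}
    (hX : 3 * Fintype.card V < 4 * X.card) (e : Fin 4 → V ≃ V) : ∃ t, ∀ i, e i t ∈ X := by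
  classical
  by_contra! hcon
  have h1 : (Finset.univ : Finset V) ⊆ Finset.univ.biUnion fun i => Xᶜ.image (e i).symm := by
    intro t _
    obtain ⟨i, hi⟩ := hcon t
    exact Finset.mem_biUnion.2 ⟨i, Finset.mem_univ _, Finset.mem_image.2
      ⟨e i t, Finset.mem_compl.2 hi, by simp⟩⟩
  have h2 := (Finset.card_le_card h1).trans Finset.card_biUnion_le
  have h3 : ∀ i ∈ (Finset.univ : Finset (Fin 4)), (Xᶜ.image (e i).symm).card = Xᶜ.card :=
    fun i _ => Finset.card_image_of_injective _ (e i).symm.injective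
  rw [Finset.sum_congr rfl h3, Finset.card_univ, Finset.card_compl] at h2
  have h4 := X.card_le_univ
  simp only [Finset.sum_const, Finset.card_univ, Fintype.card_fin, smul_eq_mul] at h2
  omega

namespace ArcSystem

variable {p m : ℕ} {V : Type*} [AddCommGroup V] {d : V → ℕ} {T : V → Set (ZMod p)}

theorem exists_linear_of_dense [Module (ZMod p) V] [Fintype V] (h : ArcSystem p m d T) (hm : 0 < m)
    (hX : 3 * Fintype.card V < 4 * (Finset.univ.filter fun z => d z = 0).card) :
    ∃ f : V →ₗ[ZMod p] ZMod p, ∀ x, d x = 0 → f x ∈ T x := by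
  classical
  choose g hg using h.nonempty
  have hadd : ∀ x y, d x = 0 → d y = 0 → d (x + y) = 0 → g (x + y) = g x + g y :=
    fun x y hx hy hxy => h.eq_of_mem hm hxy (hg _) (h.add_mem hm hx hy (hg x) (hg y))
  have hdiff : ∀ z x y, d x = 0 → d (x + z) = 0 → d y = 0 → d (y + z) = 0 →
      g (x + z) - g x = g (y + z) - g y := by
    intro z x y hx hxz hy hyz
    obtain ⟨t, ht⟩ := exists_forall_apply_mem hX
      ![Equiv.refl V, Equiv.subLeft x, Equiv.subLeft y, Equiv.addLeft z]
    have h0 : d t = 0 := by simpa using ht 0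
    have h1 : d (x - t) = 0 := by simpa using ht 1
    have h2 : d (y - t) = 0 := by simpa using ht 2
    have h3 : d (z + t) = 0 := by simpa using ht 3
    have key : ∀ w, d w = 0 → d (w + z) = 0 → d (w - t) = 0 →
        g (w + z) - g w = g (z + t) - g t := by
      intro w hw hwz hwt
      have e1 := hadd t (w - t) h0 hwt (by rwa [add_sub_cancel])
      have e2 := hadd (z + t) (w - t) h3 hwt (by rwa [show z + t + (w - t) = w + z by abel])
      rw [add_sub_cancel] at e1
      rw [show z + t + (w - t) = w + z by abel] at e2
      rw [e1, e2]
      ring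
    rw [key x hx hxz h1, key y hy hyz h2]
  have hex : ∀ z, ∃ x, d x = 0 ∧ d (x + z) = 0 := by
    intro z
    obtain ⟨t, ht⟩ := exists_forall_apply_mem hX
      ![Equiv.refl V, Equiv.addRight z, Equiv.refl V, Equiv.refl V]
    exact ⟨t, by simpa using ht 0, by simpa using ht 1⟩
  choose b hb hb' using hex
  let f₀ : V →+ ZMod p := AddMonoidHom.mk' (fun z => g (b z + z) - g (b z)) (by
    intro z w
    obtain ⟨t, ht⟩ := exists_forall_apply_mem hX
      ![Equiv.refl V, Equiv.addRight z, Equiv.addRight (z + w), Equiv.refl V]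
    have h0 : d t = 0 := by simpa using ht 0
    have h1 : d (t + z) = 0 := by simpa using ht 1
    have h2 : d (t + (z + w)) = 0 := by simpa [add_assoc] using ht 2
    rw [hdiff z _ t (hb _) (hb' _) h0 h1, hdiff (z + w) _ t (hb _) (hb' _) h0 h2,
      hdiff w _ (t + z) (hb _) (hb' _) h1 (by rwa [add_assoc]), add_assoc]
    ring)
  refine ⟨f₀.toZModLinearMap p, fun x hx => ?_⟩
  have : f₀.toZModLinearMap p x = g x := by
    change g (b x + x) - g (b x) = g x
    rw [hadd _ _ (hb x) hx (hb' x)]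
    ring
  rw [this]
  exact hg x

end ArcSystem

theorem eq_univ_of_sum_ge {p : ℕ} [Fact p.Prime] {N : ℕ} (hN : 0 < N) (a : ZMod p → ℕ)
    (ha : ∀ k, a k ≤ N) (Ω : Finset (ZMod p))
    (hΩ : ∀ i ∈ Ω, ∀ j ∈ Ω, N < a i + a j → i + j ∈ Ω) (hΩ' : ∀ k ∉ Ω, 2 * a k ≤ N)
    (hsum : (p + 2) * N ≤ 2 * ∑ k, a k) : Ω = Finset.univ := by
  by_contra hne
  have hcard : Ω.card < p := by
    have := Finset.card_lt_univ_of_notMem (s := Ω)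
      (Classical.not_forall.1 fun h => hne (Finset.eq_univ_of_forall h)).choose_spec
    rwa [ZMod.card] at this
  have hlayer : ∀ s ∈ Finset.range N, (Ω.filter fun k => s < a k).card +
      (Ω.filter fun k => N - 1 - s < a k).card ≤ Ω.card + 1 := by
    intro s hs
    rw [Finset.mem_range] at hs
    rcases (Ω.filter fun k => s < a k).eq_empty_or_nonempty with h | h
    · rw [h, Finset.card_empty, zero_add]
      exact (Finset.card_filter_le _ _).trans (Nat.le_succ _)
    rcases (Ω.filter fun k => N - 1 - s < a k).eq_empty_or_nonempty with h' | h'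
    · rw [h', Finset.card_empty, add_zero]
      exact (Finset.card_filter_le _ _).trans (Nat.le_succ _)
    have h1 := ZMod.cauchy_davenport Fact.out h h'
    have h2 : (Ω.filter fun k => s < a k) + (Ω.filter fun k => N - 1 - s < a k) ⊆ Ω := by
      intro x hx
      obtain ⟨i, hi, j, hj, rfl⟩ := Finset.mem_add.1 hx
      rw [Finset.mem_filter] at hi hj
      exact hΩ i hi.1 j hj.1 (by omega)
    have h3 := Finset.card_le_card h2
    omega
  have hcount : ∀ k, ((Finset.range N).filter fun s => s < a k).card = a k := by
    intro k
    have : ((Finset.range N).filter fun s => s < a k) = Finset.range (a k) := by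
      ext s
      have := ha k
      simp only [Finset.mem_filter, Finset.mem_range]
      omega
    rw [this, Finset.card_range]
  have hcake : ∑ s ∈ Finset.range N, (Ω.filter fun k => s < a k).card = ∑ k ∈ Ω, a k := by
    rw [← Finset.sum_congr rfl fun k _ => hcount k]
    simp only [Finset.card_filter]
    exact Finset.sum_comm
  have h1 := Finset.sum_le_sum hlayer
  rw [Finset.sum_add_distrib,
    Finset.sum_range_reflect (fun s => (Ω.filter fun k => s < a k).card) N, hcake,
    Finset.sum_const, Finset.card_range, smul_eq_mul] at h1
  have h2 : 2 * ∑ k ∈ Ωᶜ, a k ≤ (p - Ω.card) * N := by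
    rw [Finset.mul_sum]
    refine (Finset.sum_le_sum fun k hk => hΩ' k (Finset.mem_compl.1 hk)).trans ?_
    rw [Finset.sum_const, Finset.card_compl, ZMod.card, smul_eq_mul]
  have h3 := Finset.sum_add_sum_compl Ω a
  obtain ⟨q, hq⟩ := Nat.exists_eq_add_of_lt hcard
  have h4 : p - Ω.card = q + 1 := by omega
  rw [h4] at h2
  have h5 : (p + 2) * N = (Ω.card + q + 1 + 2) * N := congrArg (fun x => (x + 2) * N) hq
  nlinarith

section Fibres

variable {p : ℕ} [Fact p.Prime] {V : Type*} [AddCommGroup V] [Module (ZMod p) V] [Fintype V]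

theorem card_fibre_eq {φ : V →ₗ[ZMod p] ZMod p} (hφ : φ ≠ 0) (k : ZMod p) :
    (Finset.univ.filter fun z => φ z = k).card = (Finset.univ.filter fun z => φ z = 0).card := by
  obtain ⟨v, hv⟩ := LinearMap.surjective hφ k
  refine Finset.card_bij' (fun z _ => z - v) (fun z _ => z + v) ?_ ?_ ?_ ?_ <;> simp +contextual [hv]

theorem sum_fibres (φ : V →ₗ[ZMod p] ZMod p) {M : Type*} [AddCommMonoid M] (f : V → M) :
    ∑ k, ∑ z with φ z = k, f z = ∑ z, f z :=
  Finset.sum_fiberwise _ _ _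

theorem card_eq_mul_card_fibre {φ : V →ₗ[ZMod p] ZMod p} (hφ : φ ≠ 0) :
    Fintype.card V = p * (Finset.univ.filter fun z => φ z = 0).card := by
  have := sum_fibres φ fun _ => 1
  simp only [← Finset.card_eq_sum_ones] at this
  rw [Finset.sum_congr rfl fun k _ => card_fibre_eq hφ k] at this
  rw [← Finset.card_univ, ← this]
  simp [ZMod.card]

end Fibres

theorem card_le_card_zeros_add_sum {ι : Type*} (S : Finset ι) (d : ι → ℕ) :
    S.card ≤ (S.filter fun z => d z = 0).card + ∑ z ∈ S, d z := by
  rw [Finset.card_filter, ← Finset.sum_add_distrib, Finset.card_eq_sum_ones]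
  refine Finset.sum_le_sum fun z _ => ?_
  split_ifs <;> omega

namespace ArcSystem

variable {p m : ℕ} [Fact p.Prime] {V : Type*} [AddCommGroup V] [Module (ZMod p) V] [Fintype V]
  {d : V → ℕ} {T : V → Set (ZMod p)}

/-- If the translates of the zeros of `d` in a fibre are not all the same, then there are few of
them. -/
theorem two_mul_card_zeros_le (h : ArcSystem p m d T) (hm : 0 < m) (φ : V →ₗ[ZMod p] ZMod p)
    (h0 : ∀ x, φ x = 0 → d x = 0 → 0 ∈ T x)
    (hU : 2 * p * ∑ z with φ z = 0, d z + 2 * (Finset.univ.filter fun z => φ z = 0).card ≤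
      p * (Finset.univ.filter fun z => φ z = 0).card)
    {g : V → ZMod p} (hg : ∀ z, g z ∈ T z) {x y : V} (hxy : φ x = φ y) (hx : d x = 0)
    (hy : d y = 0) (hgxy : g x ≠ g y) :
    2 * (Finset.univ.filter fun z => φ z = φ x ∧ d z = 0).card ≤
      (Finset.univ.filter fun z => φ z = 0).card := by
  classical
  set N := (Finset.univ.filter fun z => φ z = 0).card with hN
  let U := LinearMap.ker φ
  have : Fintype U := Fintype.ofFinite U
  have hcardU : Fintype.card U = N := by
    rw [hN, ← Fintype.card_subtype]
    exact Fintype.card_congr (Equiv.refl _)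
  let P : Finset U := Finset.univ.filter fun u => d (x + u) = 0 ∧ g (x + u) = g x
  let Q : Finset U := Finset.univ.filter fun u => d (x + u) = 0 ∧ g (x + u) ≠ g x
  let Z : Finset U := Finset.univ.filter fun u => d (u : V) = 0
  have hP : P.Nonempty := ⟨0, by simp [P, hx]⟩
  have hQ : Q.Nonempty := ⟨⟨y - x, by simp [U, hxy]⟩, by simp [Q, hy, hgxy.symm]⟩
  have hPQ : P.card + Q.card = (Finset.univ.filter fun z => φ z = φ x ∧ d z = 0).card := by
    have h1 : P.card + Q.card = (Finset.univ.filter fun u : U => d (x + u) = 0).card := by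
      simp only [P, Q, ← Finset.filter_filter]
      exact Finset.card_filter_add_card_filter_not _
    rw [h1]
    refine Finset.card_bij' (fun u _ => x + u) (fun z hz => ⟨z - x, ?_⟩) ?_ ?_ ?_ ?_
    · have := (Finset.mem_filter.1 hz).2.1
      simp [U, this]
    · intro u hu
      have h2 := (Finset.mem_filter.1 hu).2
      have h3 : φ u = 0 := u.2
      simp [h2, h3]
    · intro z hz
      have := (Finset.mem_filter.1 hz).2.2
      simpa using this
    · intro u hu; simp
    · intro z hz; simp
  have hdisj : Disjoint (Q + -P) Z := by
    rw [Finset.disjoint_left]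
    intro u hu huZ
    obtain ⟨q, hq, r, hr, rfl⟩ := Finset.mem_add.1 hu
    rw [Finset.mem_neg'] at hr
    obtain ⟨hq1, hq2⟩ := (Finset.mem_filter.1 hq).2
    obtain ⟨hr1, hr2⟩ := (Finset.mem_filter.1 hr).2
    have hz := (Finset.mem_filter.1 huZ).2
    have h1 := h.add_mem hm hr1 hz (hg _) (h0 _ (q + r).2 hz)
    have h2 : x + ((-r : U) : V) + ((q + r : U) : V) = x + q := by
      push_cast; abel
    rw [h2, add_zero, hr2] at h1
    exact hq2 (h.eq_of_mem hm hq1 (hg _) h1)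
  have hZ : N ≤ Z.card + ∑ z with φ z = 0, d z := by
    have h1 := card_le_card_zeros_add_sum (Finset.univ : Finset U) fun u => d u
    have h2 : ∑ z with φ z = 0, d z = ∑ u : U, d u :=
      Finset.sum_subtype _ (by simp [U]) _
    rw [h2]
    rwa [Finset.card_univ, hcardU] at h1
  have hle : (Q + -P).card + Z.card ≤ N := by
    rw [← Finset.card_union_of_disjoint hdisj, ← hcardU]
    exact Finset.card_le_univ _
  rw [← hPQ]
  have hp := (Fact.out : p.Prime).pos
  rcases add_eq_univ_or_card_le (p := p) _ Q (-P) rfl hQ hP.neg with h1 | h1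
  · have h2 : (0 : U) ∈ Z := by simp [Z, h.defect_zero]
    exact (Finset.disjoint_left.1 hdisj (h1 ▸ Finset.mem_univ _) h2).elim
  · rw [Finset.card_neg, Nat.card_eq_fintype_card, hcardU] at h1
    have h2 := Nat.mul_le_mul_left p hle
    have h3 := Nat.mul_le_mul_left p hZ
    have h4 : p * (2 * (P.card + Q.card)) ≤ p * N := by nlinarith
    exact Nat.le_of_mul_le_mul_left h4 hp

end ArcSystem

theorem exists_mem_mem_sub_of_card_lt {G : Type*} [AddCommGroup G] [DecidableEq G]
    {F : Finset G} {A B : Finset G} {z : G} (hA : A ⊆ F) (hB : ∀ b ∈ B, z - b ∈ F)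
    (h : F.card < A.card + B.card) : ∃ x ∈ A, z - x ∈ B := by
  by_contra! hcon
  have hdisj : Disjoint A (B.image (z - ·)) := by
    rw [Finset.disjoint_left]
    intro x hx hx'
    obtain ⟨b, hb, rfl⟩ := Finset.mem_image.1 hx'
    exact hcon _ hx (by simpa using hb)
  have h1 : A ∪ B.image (z - ·) ⊆ F := by
    refine Finset.union_subset hA fun x hx => ?_
    obtain ⟨b, hb, rfl⟩ := Finset.mem_image.1 hx
    exact hB b hb
  have h2 := Finset.card_le_card h1
  rw [Finset.card_union_of_disjoint hdisj,
    Finset.card_image_of_injective _ sub_right_injective] at h2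
  omega

namespace ArcSystem

variable {p m : ℕ} [Fact p.Prime] {V : Type*} [AddCommGroup V] [Module (ZMod p) V] [Fintype V]
  {d : V → ℕ} {T : V → Set (ZMod p)}

theorem exists_common_mem (h : ArcSystem p m d T) (hm : 0 < m) {φ : V →ₗ[ZMod p] ZMod p}
    (hφ : φ ≠ 0) (h0 : ∀ x, φ x = 0 → d x = 0 → 0 ∈ T x)
    (hU : 2 * p * ∑ z with φ z = 0, d z + 2 * (Finset.univ.filter fun z => φ z = 0).card ≤
      p * (Finset.univ.filter fun z => φ z = 0).card)
    (hV : 2 * p * ∑ z, d z + 2 * Fintype.card V ≤ p * Fintype.card V) :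
    ∃ s : ZMod p → ZMod p, ∀ z, s (φ z) ∈ T z := by
  classical
  set N := (Finset.univ.filter fun z => φ z = 0).card with hN
  have hcardV : Fintype.card V = p * N := card_eq_mul_card_fibre hφ
  have hp := (Fact.out : p.Prime).pos
  have hNpos : 0 < N := Finset.card_pos.2 ⟨0, by simp⟩
  choose g hg using h.nonempty
  let X : ZMod p → Finset V := fun k => Finset.univ.filter fun z => φ z = k ∧ d z = 0
  have hXF : ∀ k, X k ⊆ Finset.univ.filter fun z => φ z = k := fun k z hz => by
    have := (Finset.mem_filter.1 hz).2.1
    simpa using this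
  have hXN : ∀ k, (X k).card ≤ N := fun k => by
    rw [hN, ← card_fibre_eq hφ k]
    exact Finset.card_le_card (hXF k)
  have hsum : (p + 2) * N ≤ 2 * ∑ k, (X k).card := by
    have h1 : ∑ k, (X k).card = (Finset.univ.filter fun z => d z = 0).card := by
      have h2 := sum_fibres φ fun z => if d z = 0 then 1 else 0
      rw [Finset.card_filter, ← h2]
      refine Finset.sum_congr rfl fun k _ => ?_
      rw [← Finset.card_filter, Finset.filter_filter]
    have h2 := card_le_card_zeros_add_sum (Finset.univ : Finset V) d
    rw [← h1, Finset.card_univ] at h2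
    have h3 := Nat.mul_le_mul_left (2 * p) h2
    rw [hcardV] at h3 hV
    have h4 : p * ((p + 2) * N) ≤ p * (2 * ∑ k, (X k).card) := by nlinarith
    exact Nat.le_of_mul_le_mul_left h4 hp
  have hgadd : ∀ i j γ γ', (∀ x ∈ X i, g x = γ) → (∀ x ∈ X j, g x = γ') →
      N < (X i).card + (X j).card → ∀ z, φ z = i + j → γ + γ' ∈ T z := by
    intro i j γ γ' hi hj hij z hz
    obtain ⟨x, hx, hy⟩ := exists_mem_mem_sub_of_card_lt (z := z) (hXF i) (B := X j) (by
      intro b hb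
      have := (Finset.mem_filter.1 hb).2.1
      simp [hz, this]) (by rwa [card_fibre_eq hφ i])
    have := h.add_mem hm (Finset.mem_filter.1 hx).2.2 (Finset.mem_filter.1 hy).2.2 (hg _) (hg _)
    rwa [add_sub_cancel, hi x hx, hj _ hy] at this
  let Ω : Finset (ZMod p) := Finset.univ.filter fun k => ∃ γ, ∀ x ∈ X k, g x = γ
  have hΩ : Ω = Finset.univ := by
    apply eq_univ_of_sum_ge hNpos (fun k => (X k).card) hXN Ω _ _ hsum
    · intro i hi j hj hij
      obtain ⟨γ, hγ⟩ := (Finset.mem_filter.1 hi).2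
      obtain ⟨γ', hγ'⟩ := (Finset.mem_filter.1 hj).2
      refine Finset.mem_filter.2 ⟨Finset.mem_univ _, γ + γ', fun z hz => ?_⟩
      obtain ⟨hz1, hz2⟩ := (Finset.mem_filter.1 hz).2
      exact h.eq_of_mem hm hz2 (hg z) (hgadd i j γ γ' hγ hγ' hij z hz1)
    · intro k hk
      have hk : ¬ ∃ γ, ∀ x ∈ X k, g x = γ := by simpa [Ω] using hk
      have hne : (X k).Nonempty := by
        by_contra hcon
        rw [Finset.not_nonempty_iff_eq_empty] at hcon
        exact hk ⟨0, by simp [hcon]⟩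
      obtain ⟨x, hx⟩ := hne
      obtain ⟨y, hy, hyx⟩ : ∃ y ∈ X k, g y ≠ g x := by
        by_contra! hcon
        exact hk ⟨_, hcon⟩
      obtain ⟨hx1, hx2⟩ := (Finset.mem_filter.1 hx).2
      obtain ⟨hy1, hy2⟩ := (Finset.mem_filter.1 hy).2
      have := h.two_mul_card_zeros_le hm φ h0 hU hg (hx1.trans hy1.symm) hx2 hy2 hyx.symm
      rwa [hx1] at this
  have hγ : ∀ k, ∃ γ, ∀ x ∈ X k, g x = γ := fun k =>
    (Finset.mem_filter.1 (show k ∈ Ω by rw [hΩ]; exact Finset.mem_univ k)).2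
  choose γ hγ using hγ
  have hi : ∀ k, ∃ i, N < (X i).card + (X (k - i)).card := by
    intro k
    by_contra! hcon
    have h1 := Finset.sum_le_sum fun i (_ : i ∈ Finset.univ) => hcon i
    have h2 : ∑ i, (X (k - i)).card = ∑ i, (X i).card :=
      Equiv.sum_comp (Equiv.subLeft k) fun i => (X i).card
    rw [Finset.sum_add_distrib, h2,
      Finset.sum_const, Finset.card_univ, ZMod.card, smul_eq_mul] at h1
    nlinarith
  choose i hi using hi
  refine ⟨fun k => γ (i k) + γ (k - i k), fun z => ?_⟩
  exact hgadd _ _ _ _ (hγ _) (hγ _) (hi (φ z)) z (by ring)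

end ArcSystem

namespace ArcSystem

variable {p m : ℕ} [Fact p.Prime] {V : Type*} [AddCommGroup V] [Module (ZMod p) V] [Fintype V]
  {d : V → ℕ} {T : V → Set (ZMod p)}

theorem exists_coboundary (h : ArcSystem p m d T) (hpm : p + 1 = 3 * m) (hp : 11 ≤ p)
    {φ : V →ₗ[ZMod p] ZMod p}
    (hV : 2 * p * ∑ z, d z + 2 * Fintype.card V ≤ p * Fintype.card V)
    (hX : 4 * (Finset.univ.filter fun z => d z = 0).card ≤ 3 * Fintype.card V)
    {s : ZMod p → ZMod p} (hs : ∀ z, s (φ z) ∈ T z) {x : V} (hx : d x = 0) (hφx : φ x ≠ 0) :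
    ∃ D : ZMod p → ℤ, (∀ k, (D k : ZMod p) = s (k + φ x) - s k - s (φ x)) ∧
      ∑ k, |D k| ≤ (p : ℤ) - 2 := by
  classical
  have hφ : φ ≠ 0 := by rintro rfl; simp at hφx
  set N := (Finset.univ.filter fun z => φ z = 0).card with hN
  have hcardV : Fintype.card V = p * N := card_eq_mul_card_fibre hφ
  have hNpos : 0 < N := Finset.card_pos.2 ⟨0, by simp⟩
  rw [hcardV] at hV hX
  have hsum : 2 * ∑ z, d z + 2 * N ≤ p * N := by
    have : p * (2 * ∑ z, d z + 2 * N) ≤ p * (p * N) := by nlinarith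
    exact Nat.le_of_mul_le_mul_left this (by omega)
  have hexc : 4 * ∑ z, (d z - 1) + 4 * N ≤ p * N := by
    have h1 : ∑ z, d z = ∑ z, (d z - 1) + (Finset.univ.filter fun z => ¬ d z = 0).card := by
      rw [Finset.card_filter, ← Finset.sum_add_distrib]
      refine Finset.sum_congr rfl fun z _ => ?_
      split_ifs <;> omega
    have h2 := Finset.card_filter_add_card_filter_not (s := (Finset.univ : Finset V))
      (fun z => d z = 0)
    rw [Finset.card_univ, hcardV] at h2
    omega
  have hfib : ∀ k, ∑ z with φ z = k, (d z + d (z + x)) < m * N := by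
    intro k
    have h1 : ∑ z with φ z = k, (d z + d (z + x)) ≤
        ∑ z with φ z = k, (2 + ((d z - 1) + (d (z + x) - 1))) :=
      Finset.sum_le_sum fun z _ => by omega
    have h2 : ∑ z with φ z = k, (d (z + x) - 1) = ∑ z with φ z = k + φ x, (d z - 1) := by
      refine Finset.sum_nbij' (fun z => z + x) (fun z => z - x) ?_ ?_ ?_ ?_ ?_ <;>
        simp +contextual
    have h3 : ∑ z with φ z = k, (d z - 1) + ∑ z with φ z = k + φ x, (d z - 1) ≤
        ∑ z, (d z - 1) := by
      rw [← Finset.sum_union]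
      · exact Finset.sum_le_sum_of_subset (Finset.subset_univ _)
      · rw [Finset.disjoint_filter]
        intro z _ hz hz'
        rw [hz] at hz'
        exact hφx (by simpa using hz')
    refine h1.trans_lt ?_
    rw [Finset.sum_add_distrib, Finset.sum_add_distrib, h2, Finset.sum_const, card_fibre_eq hφ k,
      ← hN, smul_eq_mul]
    have h4 : (p + 8) * N ≤ 4 * m * N + 3 * N := Nat.le_trans
      (Nat.mul_le_mul_right N (show p + 8 ≤ 4 * m + 3 by omega)) (by rw [add_mul])
    nlinarith
  have hD : ∀ k, ∃ D : ℤ, (D : ZMod p) = s (k + φ x) - s k - s (φ x) ∧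
      N * |D| ≤ ∑ z with φ z = k, ((d z + d (z + x) : ℕ) : ℤ) := by
    intro k
    have hne : (Finset.univ.filter fun z => φ z = k).Nonempty :=
      (LinearMap.surjective hφ k).imp fun z hz => by simpa using hz
    obtain ⟨z, hz, hmin⟩ := Finset.exists_min_image _ (fun z => d z + d (z + x)) hne
    have hzk : φ z = k := by simpa using hz
    have h1 : N * (d z + d (z + x)) ≤ ∑ z with φ z = k, (d z + d (z + x)) := by
      rw [hN, ← card_fibre_eq hφ k, ← smul_eq_mul]
      exact Finset.card_nsmul_le_sum _ _ _ hmin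
    have h2 : d z + d (z + x) < m := by
      have := h1.trans_lt (hfib k)
      rw [mul_comm] at this
      exact Nat.lt_of_mul_lt_mul_right this
    obtain ⟨t, ht, ht'⟩ := h.add x hx _ (hs x) z
    rw [add_comm x z] at ht'
    obtain ⟨i, hi, hi'⟩ := h.close z (by omega) t ht _ (hs z)
    obtain ⟨j, hj, hj'⟩ := h.close (z + x) (by omega) _ (hs (z + x)) _ ht'
    refine ⟨i + j, ?_, ?_⟩
    · push_cast
      rw [hi', hj', map_add, hzk]
      ring
    · have h3 := abs_add_le i j
      have h4 : (N : ℤ) * |i + j| ≤ N * ((d z + d (z + x) : ℕ) : ℤ) :=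
        mul_le_mul_of_nonneg_left (by push_cast; linarith) (by positivity)
      refine h4.trans ?_
      exact_mod_cast h1
  choose D hD hD' using hD
  refine ⟨D, hD, ?_⟩
  have h1 := Finset.sum_le_sum fun k (_ : k ∈ Finset.univ) => hD' k
  rw [← Finset.mul_sum, sum_fibres φ fun z => ((d z + d (z + x) : ℕ) : ℤ), ← Nat.cast_sum,
    Finset.sum_add_distrib] at h1
  have h2 : ∑ z, d (z + x) = ∑ z, d z := Equiv.sum_comp (Equiv.addRight x) d
  rw [h2] at h1
  have h3 : (2 * ∑ z, d z + 2 * N : ℤ) ≤ p * N := by exact_mod_cast hsum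
  push_cast at h1
  have h4 : (N : ℤ) * ∑ k, |D k| ≤ N * (p - 2) := by linarith
  exact le_of_mul_le_mul_left h4 (by exact_mod_cast hNpos)

theorem exists_mul_apply_mem (h : ArcSystem p m d T) (hpm : p + 1 = 3 * m) (hp : 11 ≤ p)
    {φ : V →ₗ[ZMod p] ZMod p} (hφ : φ ≠ 0) (h0 : ∀ x, φ x = 0 → d x = 0 → 0 ∈ T x)
    (hU : 2 * p * ∑ z with φ z = 0, d z + 2 * (Finset.univ.filter fun z => φ z = 0).card ≤
      p * (Finset.univ.filter fun z => φ z = 0).card)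
    (hV : 2 * p * ∑ z, d z + 2 * Fintype.card V ≤ p * Fintype.card V)
    (hX : 4 * (Finset.univ.filter fun z => d z = 0).card ≤ 3 * Fintype.card V) :
    ∃ c : ZMod p, ∀ x, d x = 0 → c * φ x ∈ T x := by
  have hm : 0 < m := by omega
  obtain ⟨s, hs⟩ := h.exists_common_mem hm hφ h0 hU hV
  have hs0 : s 0 = 0 := by
    have := hs 0
    rw [map_zero] at this
    exact h.eq_of_mem hm h.defect_zero this h.zero_mem
  by_cases hex : ∃ x, d x = 0 ∧ φ x ≠ 0
  swap
  · push Not at hex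
    refine ⟨0, fun x hx => ?_⟩
    rw [zero_mul]
    exact h0 x (hex x hx) hx
  obtain ⟨x, hx, hφx⟩ := hex
  refine ⟨s (φ x) / φ x, fun y hy => ?_⟩
  by_cases hφy : φ y = 0
  · rw [hφy, mul_zero]
    exact h0 y hφy hy
  obtain ⟨D, hD, hD'⟩ := h.exists_coboundary hpm hp hV hX hs hx hφx
  obtain ⟨E, hE, hE'⟩ := h.exists_coboundary hpm hp hV hX hs hy hφy
  have hcomp : ∀ f : ZMod p → ℤ, ∑ k, |f (φ x * k)| = ∑ k, |f k| := fun f =>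
    Equiv.sum_comp (Equiv.mulLeft₀ _ hφx) fun k => |f k|
  have h1 := eq_zero_of_winding (fun k => s (φ x * k) - k * s (φ x)) (fun k => D (φ x * k))
    (fun k => E (φ x * k)) (φ y / φ x) (by simp [hs0])
    (fun k => by
      simp only [hD]
      rw [show φ x * (k + 1) = φ x * k + φ x by ring]
      ring)
    (fun k => by
      have h2 : φ x * (φ y / φ x) = φ y := mul_div_cancel₀ _ hφx
      simp only [hE]
      rw [mul_add, h2]
      ring)
    (by rwa [hcomp]) (by rwa [hcomp])
  simp only [mul_div_cancel₀ _ hφx] at h1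
  have h3 : s (φ x) / φ x * φ y = s (φ y) := by
    rw [sub_eq_zero.1 h1]
    ring
  rw [h3]
  exact hs y

end ArcSystem

theorem exists_functional_sum_ker_le {p : ℕ} [Fact p.Prime] {V : Type*} [AddCommGroup V]
    [Module (ZMod p) V] [Fintype V] [Nontrivial V] {d : V → ℕ} (hd : d 0 = 0)
    (hV : 2 * p * ∑ z, d z + 2 * Fintype.card V ≤ p * Fintype.card V) :
    ∃ φ : V →ₗ[ZMod p] ZMod p, φ ≠ 0 ∧
      2 * p * ∑ z with φ z = 0, d z + 2 * (Finset.univ.filter fun z => φ z = 0).card ≤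
        p * (Finset.univ.filter fun z => φ z = 0).card := by
  classical
  by_contra! hcon
  have hp := (Fact.out : p.Prime).two_le
  have : Fintype (V →ₗ[ZMod p] ZMod p) :=
    have : Finite (V →ₗ[ZMod p] ZMod p) := DFunLike.finite _
    Fintype.ofFinite _
  obtain ⟨k, hk⟩ := Nat.exists_eq_succ_of_ne_zero
    (Module.finrank_pos (R := ZMod p) (M := V)).ne'
  set N := p ^ k with hN
  have hNpos : 0 < N := by positivity
  have hcardV : Fintype.card V = p * N := by
    rw [← Nat.card_eq_fintype_card, Module.natCard_eq_pow_finrank (K := ZMod p), hk,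
      Nat.card_zmod, pow_succ']
  have hcardD : Fintype.card (V →ₗ[ZMod p] ZMod p) = p * N := by
    rw [← Nat.card_eq_fintype_card, Module.natCard_eq_pow_finrank (K := ZMod p),
      Module.finrank_linearMap_self, hk, Nat.card_zmod, pow_succ']
  have hker : ∀ φ : V →ₗ[ZMod p] ZMod p, φ ≠ 0 →
      (Finset.univ.filter fun z => φ z = 0).card = N := by
    intro φ hφ
    have := card_eq_mul_card_fibre hφ
    rw [hcardV] at this
    exact (Nat.eq_of_mul_eq_mul_left (by omega) this).symm
  have hev : ∀ z : V, z ≠ 0 →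
      (Finset.univ.filter fun φ : V →ₗ[ZMod p] ZMod p => φ ≠ 0 ∧ φ z = 0).card = N - 1 := by
    intro z hz
    have h1 : LinearMap.applyₗ (R := ZMod p) (M₂ := ZMod p) z ≠ 0 := by
      intro h
      obtain ⟨φ, hφ⟩ := Module.Projective.exists_dual_ne_zero (ZMod p) hz
      exact hφ (LinearMap.congr_fun h φ)
    have h2 := card_eq_mul_card_fibre h1
    rw [hcardD] at h2
    have h3 := Nat.eq_of_mul_eq_mul_left (by omega) h2
    have h4 : (Finset.univ.filter fun φ : V →ₗ[ZMod p] ZMod p => φ ≠ 0 ∧ φ z = 0) =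
        (Finset.univ.filter fun φ : V →ₗ[ZMod p] ZMod p => φ z = 0).erase 0 := by
      ext φ; simp
    rw [h4, Finset.card_erase_of_mem (by simp), h3]
    simp
  have hsum : ∑ φ : V →ₗ[ZMod p] ZMod p with φ ≠ 0, ∑ z with φ z = 0, d z =
      (N - 1) * ∑ z, d z := by
    have h1 : ∀ φ : V →ₗ[ZMod p] ZMod p,
        ∑ z with φ z = 0, d z = ∑ z, if φ z = 0 then d z else 0 :=
      fun φ => Finset.sum_filter _ _
    rw [Finset.sum_congr rfl fun φ _ => h1 φ, Finset.sum_comm, Finset.mul_sum]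
    refine Finset.sum_congr rfl fun z _ => ?_
    rw [← Finset.sum_filter, Finset.filter_filter, Finset.sum_const, smul_eq_mul]
    rcases eq_or_ne z 0 with rfl | hz
    · simp [hd]
    · rw [hev z hz]
  have hcount : (Finset.univ.filter fun φ : V →ₗ[ZMod p] ZMod p => φ ≠ 0).card = p * N - 1 := by
    rw [Finset.filter_ne', Finset.card_erase_of_mem (Finset.mem_univ _), Finset.card_univ, hcardD]
  have h1 : ∑ φ : V →ₗ[ZMod p] ZMod p with φ ≠ 0, (p * N + 1) ≤
      ∑ φ : V →ₗ[ZMod p] ZMod p with φ ≠ 0, (2 * p * ∑ z with φ z = 0, d z + 2 * N) := by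
    refine Finset.sum_le_sum fun φ hφ => ?_
    have hφ := (Finset.mem_filter.1 hφ).2
    have := hcon φ hφ
    rw [hker φ hφ] at this
    exact this
  rw [Finset.sum_const, Finset.sum_add_distrib, ← Finset.mul_sum, hsum, Finset.sum_const, hcount,
    smul_eq_mul, smul_eq_mul] at h1
  rw [hcardV] at hV
  obtain ⟨M, hM⟩ := Nat.exists_eq_succ_of_ne_zero hNpos.ne'
  obtain ⟨q, hq⟩ := Nat.exists_eq_add_of_le hp
  have h2 : p * N - 1 = p * M + q + 1 := by
    rw [hM, Nat.succ_eq_add_one, mul_add]; omega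
  rw [h2, show N - 1 = M by omega] at h1
  generalize ∑ z, d z = S at *
  have h3 : 2 * p * S ≤ q * (p * N) := by
    have : p * (p * N) = q * (p * N) + 2 * (p * N) := by
      nth_rw 1 [hq]; ring
    omega
  have h4 := Nat.mul_le_mul_left M h3
  have h5 : p * N = q * N + 2 * N := by rw [hq]; ring
  have h6 : (p * M + q + 1) * (p * N + 1) =
      (p * M + q + 1) * (2 * N) + (p * M) * (q * N) + ((q + 1) * (q * N) + p * M + q + 1) := by
    rw [h5]; ring
  nlinarith [Nat.zero_le ((q + 1) * (q * N))]

theorem ArcSystem.exists_linear {p m : ℕ} [Fact p.Prime] (hpm : p + 1 = 3 * m) (hp : 11 ≤ p) :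
    ∀ (n : ℕ) (V : Type*) [AddCommGroup V] [Module (ZMod p) V] [Fintype V] (d : V → ℕ)
      (T : V → Set (ZMod p)), Module.finrank (ZMod p) V = n → ArcSystem p m d T →
      2 * p * ∑ z, d z + 2 * Fintype.card V ≤ p * Fintype.card V →
      ∃ f : V →ₗ[ZMod p] ZMod p, ∀ x, d x = 0 → f x ∈ T x := by
  intro n
  induction n using Nat.strong_induction_on with
  | _ n ih =>
  intro V _ _ _ d T hn h hV
  classical
  rcases Nat.lt_or_ge (3 * Fintype.card V) (4 * (Finset.univ.filter fun z => d z = 0).card)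
    with hX | hX
  · exact h.exists_linear_of_dense (by omega) hX
  have : Nontrivial V := by
    by_contra hcon
    rw [not_nontrivial_iff_subsingleton] at hcon
    have h1 : (Finset.univ.filter fun z => d z = 0) = Finset.univ :=
      Finset.filter_true_of_mem fun z _ => by rw [Subsingleton.elim z 0, h.defect_zero]
    have h2 : 0 < Fintype.card V := Fintype.card_pos
    rw [h1, Finset.card_univ] at hX
    omega
  obtain ⟨φ, hφ, hU⟩ := exists_functional_sum_ker_le h.defect_zero hV
  let U := LinearMap.ker φ
  have : Fintype U := Fintype.ofFinite U
  have hcardU : (Finset.univ.filter fun z => φ z = 0).card = Fintype.card U := by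
    rw [← Fintype.card_subtype]
    exact Fintype.card_congr (Equiv.refl _)
  have hsumU : ∑ z with φ z = 0, d z = ∑ u : U, d u := Finset.sum_subtype _ (by simp [U]) _
  have hlt : Module.finrank (ZMod p) U < n := by
    rw [← hn]
    exact Submodule.finrank_lt fun htop => hφ (LinearMap.ker_eq_top.1 htop)
  obtain ⟨f, hf⟩ := ih _ hlt U _ _ rfl (h.restrict U) (by rwa [hsumU, hcardU] at hU)
  obtain ⟨g, hg⟩ := LinearMap.exists_extend f
  obtain ⟨c, hc⟩ := (h.shear g).exists_mul_apply_mem hpm hp hφ (by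
    intro x hx hdx
    have h1 := hf ⟨x, hx⟩ hdx
    rw [← hg] at h1
    simpa using h1) hU hV hX
  exact ⟨c • φ + g, fun x hx => by simpa using hc x hx⟩

section Line

variable {p m : ℕ} [Fact p.Prime]

theorem exists_add_eq_of_notMem_middleArc (hpm : p + 1 = 3 * m) (hm : 2 ≤ m) {t : ZMod p}
    (ht : t ∉ middleArc p m) : ∃ a ∈ middleArc p m, ∃ b ∈ middleArc p m, a + b = t := by
  obtain ⟨i, hi, rfl⟩ := (notMem_middleArc_iff hpm hm).1 ht
  rw [abs_lt] at hi
  have key : ∀ j : ℕ, j < m → ((m + j : ℕ) : ZMod p) ∈ middleArc p m := fun j hj =>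
    mem_middleArc.2 ⟨m + j, by omega, by omega, rfl⟩
  refine ⟨_, key i.toNat (by omega), _, neg_mem_middleArc hpm hm (key (-i).toNat (by omega)), ?_⟩
  have h1 : ((i.toNat - (-i).toNat : ℤ) : ZMod p) = i := by rw [Int.toNat_sub_toNat_neg]
  push_cast at h1 ⊢
  rw [← h1]
  ring

/-- A sum-free set of residues of maximal size is a dilate of the middle arc. -/
theorem exists_mul_mem_iff_of_sumFree (hpm : p + 1 = 3 * m) (hm : 2 ≤ m) (S : Finset (ZMod p))
    (hS : ∀ a ∈ S, ∀ b ∈ S, a + b ∉ S) (hSm : m ≤ S.card) :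
    ∃ r : ZMod p, r ≠ 0 ∧ ∀ t, t * r ∈ S ↔ t ∈ middleArc p m := by
  have hne : S.Nonempty := Finset.card_pos.1 (by omega)
  have hcd := ZMod.cauchy_davenport Fact.out hne hne
  have hdisj : Disjoint S (S + S) := by
    rw [Finset.disjoint_right]
    intro x hx
    obtain ⟨a, ha, b, hb, rfl⟩ := Finset.mem_add.1 hx
    exact hS a ha b hb
  have hcard := Finset.card_le_univ (S ∪ (S + S))
  rw [Finset.card_union_of_disjoint hdisj, ZMod.card] at hcard
  have hScard : S.card = m := by omega
  have hSScard : (S + S).card = 2 * m - 1 := by omega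
  have hSuniv : S ∪ (S + S) = Finset.univ := by
    apply Finset.eq_univ_of_card
    rw [Finset.card_union_of_disjoint hdisj, ZMod.card]
    omega
  have hmem : ∀ x, x ∈ S ↔ x ∉ S + S := by
    intro x
    refine ⟨fun h => Finset.disjoint_left.1 hdisj h, fun h => ?_⟩
    have := Finset.mem_univ x
    rw [← hSuniv] at this
    exact (Finset.mem_union.1 this).resolve_right h
  obtain ⟨a, r, hr, l, hl⟩ := isProgression_add _ S S rfl (by omega) (by omega) (by omega)
    (by omega)
  have hlp : l < p := by
    by_contra! hlp
    have : S + S = Finset.univ := by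
      rw [hl]
      refine Finset.eq_univ_of_forall fun x => Finset.mem_image.2 ⟨((x - a) / r).val, ?_, ?_⟩
      · exact Finset.mem_range.2 ((ZMod.val_lt _).trans_le hlp)
      · rw [ZMod.natCast_zmod_val, div_mul_cancel₀ _ hr]
        ring
    rw [this, Finset.card_univ, ZMod.card] at hSScard
    omega
  have hlcard : l = 2 * m - 1 := by
    rw [hl, Finset.card_image_of_injOn, Finset.card_range] at hSScard
    · exact hSScard
    · intro i hi j hj hij
      simp only [Finset.coe_range, Set.mem_Iio] at hi hj
      have h1 : (i : ZMod p) = j := mul_right_cancel₀ hr (add_left_cancel hij)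
      have := int_eq_of_cast_eq (p := p) (a := i) (b := j) (by simpa using h1)
        (by rw [abs_lt]; constructor <;> omega)
      exact_mod_cast this
  set c := a / r + ((m - 1 : ℕ) : ZMod p) with hc
  have hac : a = (c - ((m - 1 : ℕ) : ZMod p)) * r := by
    rw [hc, add_sub_cancel_right, div_mul_cancel₀ _ hr]
  have hiff : ∀ t, t * r ∈ S ↔ t - c ∈ middleArc p m := by
    intro t
    rw [hmem, ← not_iff_not, not_not, notMem_middleArc_iff hpm hm, hl, Finset.mem_image]
    constructor
    · rintro ⟨i, hi, hit⟩
      rw [Finset.mem_range] at hi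
      refine ⟨(i : ℤ) - (m - 1 : ℕ), by rw [abs_lt]; constructor <;> omega, ?_⟩
      apply mul_right_cancel₀ hr
      push_cast
      rw [sub_mul, sub_mul t, ← hit, hac]
      ring
    · rintro ⟨i, hi, hit⟩
      rw [abs_lt] at hi
      refine ⟨(i + (m - 1 : ℕ)).toNat, Finset.mem_range.2 (by omega), ?_⟩
      have h1 : (((i + (m - 1 : ℕ)).toNat : ℤ) : ZMod p) = (i + (m - 1 : ℕ) : ℤ) := by
        rw [Int.toNat_of_nonneg (by omega)]
      rw [Int.cast_natCast] at h1
      rw [h1]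
      push_cast
      rw [hit, hac]
      ring
  have hc0 : c = 0 := by
    by_contra hc0
    have h1 : (middleArc p m)ᶜ = Finset.univ := by
      apply eq_univ_of_add_mem _ hc0
      · intro t ht
        rw [Finset.mem_compl] at ht ⊢
        obtain ⟨x, hx, y, hy, rfl⟩ := exists_add_eq_of_notMem_middleArc hpm hm ht
        intro hcon
        refine hS ((x + c) * r) ((hiff _).2 (by simpa using hx)) ((y + c) * r)
          ((hiff _).2 (by simpa using hy)) ?_
        rw [← add_mul, hiff]
        convert hcon using 1
        ring
      · apply Finset.card_pos.1
        rw [Finset.card_compl, ZMod.card, card_middleArc hpm]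
        omega
    have h2 := card_middleArc hpm
    rw [Finset.compl_eq_univ_iff] at h1
    rw [h1, Finset.card_empty] at h2
    omega
  exact ⟨r, hr, fun t => by rw [hiff, hc0, sub_zero]⟩

theorem exists_full_line {G : Type*} [AddCommGroup G] [Module (ZMod p) G] [Fintype G]
    [DecidableEq G] (hpm : p + 1 = 3 * m) (hp : 11 ≤ p) (A : Finset G)
    (hA : ∀ a ∈ A, ∀ b ∈ A, a + b ∉ A) {Q : ℕ} (hG : Fintype.card G = p * Q) (hQ : 0 < Q)
    (hcard : 2 * p * m * Q + 2 * Q ≤ 2 * p * A.card + p * Q) :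
    ∃ v : G, v ≠ 0 ∧ ∀ t : ZMod p, t • v ∈ A ↔ t ∈ middleArc p m := by
  have h0 : (0 : G) ∉ A := fun h => hA 0 h 0 h (by simpa using h)
  have hex : ∃ v : G, v ≠ 0 ∧ m ≤ (Finset.univ.filter fun t : ZMod p => t • v ∈ A).card := by
    by_contra! hcon
    have h1 : ∑ v ∈ Finset.univ.erase (0 : G),
        (Finset.univ.filter fun t : ZMod p => t • v ∈ A).card = (p - 1) * A.card := by
      simp only [Finset.card_filter]
      rw [Finset.sum_comm, ← Finset.add_sum_erase _ _ (Finset.mem_univ (0 : ZMod p))]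
      have h2 : ∀ t ∈ Finset.univ.erase (0 : ZMod p),
          (∑ v ∈ Finset.univ.erase (0 : G), if t • v ∈ A then 1 else 0) = A.card := by
        intro t ht
        have ht := Finset.ne_of_mem_erase ht
        rw [← Finset.card_filter]
        refine Finset.card_bij' (fun v _ => t • v) (fun a _ => t⁻¹ • a) ?_ ?_ ?_ ?_
        · intro v hv; exact (Finset.mem_filter.1 hv).2
        · intro a ha
          have : a ≠ 0 := fun h => h0 (h ▸ ha)
          simp [smul_smul, ht, ha, this]
        · intro v _; simp [smul_smul, ht]
        · intro a _; simp [smul_smul, ht]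
      rw [Finset.sum_congr rfl h2, Finset.sum_const, Finset.card_erase_of_mem (Finset.mem_univ _),
        Finset.card_univ, ZMod.card, smul_eq_mul]
      simp [h0]
    have h2 : ∑ v ∈ Finset.univ.erase (0 : G),
        (Finset.univ.filter fun t : ZMod p => t • v ∈ A).card ≤
        ∑ v ∈ Finset.univ.erase (0 : G), (m - 1) :=
      Finset.sum_le_sum fun v hv => Nat.le_sub_one_of_lt (hcon v (Finset.ne_of_mem_erase hv))
    rw [h1, Finset.sum_const, Finset.card_erase_of_mem (Finset.mem_univ _), Finset.card_univ, hG,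
      smul_eq_mul] at h2
    obtain ⟨k, rfl⟩ : ∃ k, m = k + 1 := ⟨m - 1, by omega⟩
    obtain rfl : p = 3 * k + 2 := by omega
    have h3 : (3 * k + 1) * A.card ≤ (3 * k + 2) * Q * k :=
      (by simpa using h2 : (3 * k + 1) * A.card ≤ ((3 * k + 2) * Q - 1) * k).trans
        (Nat.mul_le_mul_right _ (Nat.sub_le _ _))
    nlinarith [Nat.mul_le_mul_left (3 * k + 1) hcard, Nat.mul_le_mul_left (2 * (3 * k + 2)) h3,
      Nat.zero_le (k * Q), Nat.zero_le (k * k * Q), Nat.zero_le (k * k * k * Q)]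
  obtain ⟨v, hv, hvm⟩ := hex
  obtain ⟨r, hr, hiff⟩ := exists_mul_mem_iff_of_sumFree hpm (by omega) _ (by
    intro a ha b hb hab
    simp only [Finset.mem_filter, Finset.mem_univ, true_and] at ha hb hab
    rw [add_smul] at hab
    exact hA _ ha _ hb hab) hvm
  refine ⟨r • v, smul_ne_zero hr hv, fun t => ?_⟩
  rw [← hiff]
  simp [smul_smul]

end Line

section Fibres

variable {p m : ℕ} [Fact p.Prime] {V : Type*} [AddCommGroup V]

theorem fibre_sub_notMem {B : V → Finset (ZMod p)}
    (h0 : B 0 = middleArc p m)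
    (hB : ∀ x y, ∀ s ∈ B x, ∀ t ∈ B y, s + t ∉ B (x + y)) (z : V) :
    ∀ a ∈ B z, ∀ b ∈ B z, a - b ∉ middleArc p m := by
  intro a ha b hb h
  exact hB 0 z _ (h0 ▸ h) b hb (by simpa using ha)

theorem arcSystem_fibres (hpm : p + 1 = 3 * m) (hm : 2 ≤ m) {B : V → Finset (ZMod p)}
    (h0 : B 0 = middleArc p m)
    (hB : ∀ x y, ∀ s ∈ B x, ∀ t ∈ B y, s + t ∉ B (x + y)) :
    ArcSystem p m (fun z => m - (B z).card) fun z => {t | ∀ b ∈ B z, b - t ∈ middleArc p m} where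
  defect_zero := by simp [h0, card_middleArc hpm]
  zero_mem := by simp [h0]
  nonempty z := exists_sub_mem_middleArc hpm hm _ (fibre_sub_notMem h0 hB z)
  close z hz t ht t' ht' := by
    obtain ⟨i, hi, hi'⟩ := exists_int_sub_eq hpm hm (B z)
      (Finset.card_pos.1 (by omega)) ht ht'
    exact ⟨i, by omega, hi'⟩
  add x hx g hg z := by
    classical
    have himg : (B x).image (· - g) = middleArc p m := by
      apply Finset.eq_of_subset_of_card_le
      · intro c hc
        obtain ⟨b, hb, rfl⟩ := Finset.mem_image.1 hc
        exact hg b hb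
      · rw [Finset.card_image_of_injective _ sub_left_injective, card_middleArc hpm]
        omega
    have hcross : ∀ b ∈ B z, ∀ c ∈ B (x + z), c - g - b ∉ middleArc p m := by
      intro b hb c hc h
      rw [← himg] at h
      obtain ⟨a, ha, hab⟩ := Finset.mem_image.1 h
      refine hB x z a ha b hb ?_
      have : a + b = c := by linear_combination hab
      rwa [this]
    obtain ⟨t, ht⟩ := exists_sub_mem_middleArc hpm hm (B z ∪ (B (x + z)).image (· - g)) (by
      intro a ha b hb
      rcases Finset.mem_union.1 ha with ha | ha <;> rcases Finset.mem_union.1 hb with hb | hb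
      · exact fibre_sub_notMem h0 hB z a ha b hb
      · obtain ⟨c, hc, rfl⟩ := Finset.mem_image.1 hb
        intro h
        have := neg_mem_middleArc hpm hm h
        rw [neg_sub] at this
        exact hcross a ha c hc this
      · obtain ⟨c, hc, rfl⟩ := Finset.mem_image.1 ha
        exact hcross b hb c hc
      · obtain ⟨c, hc, rfl⟩ := Finset.mem_image.1 ha
        obtain ⟨c', hc', rfl⟩ := Finset.mem_image.1 hb
        rw [sub_sub_sub_cancel_right]
        exact fibre_sub_notMem h0 hB _ c hc c' hc')
    refine ⟨t, fun b hb => ht b (Finset.mem_union_left _ hb), fun c hc => ?_⟩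
    have := ht (c - g) (Finset.mem_union_right _ (Finset.mem_image_of_mem _ hc))
    rwa [sub_sub, add_comm] at this

theorem card_fibre_le (hpm : p + 1 = 3 * m) (hm : 2 ≤ m) {B : V → Finset (ZMod p)}
    (h0 : B 0 = middleArc p m)
    (hB : ∀ x y, ∀ s ∈ B x, ∀ t ∈ B y, s + t ∉ B (x + y)) (z : V) : (B z).card ≤ m := by
  obtain ⟨t, ht⟩ := (arcSystem_fibres hpm hm h0 hB).nonempty z
  rw [← card_middleArc hpm, ← Finset.card_image_of_injective (B z) (sub_left_injective (b := t))]
  apply Finset.card_le_card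
  intro c hc
  obtain ⟨b, hb, rfl⟩ := Finset.mem_image.1 hc
  exact ht b hb

theorem exists_linear_of_fibres [Module (ZMod p) V] [Fintype V] (hpm : p + 1 = 3 * m) (hp : 11 ≤ p)
    {B : V → Finset (ZMod p)} (h0 : B 0 = middleArc p m)
    (hB : ∀ x y, ∀ s ∈ B x, ∀ t ∈ B y, s + t ∉ B (x + y))
    (hcard : 2 * p * m * Fintype.card V + 2 * Fintype.card V ≤
      2 * p * ∑ z, (B z).card + p * Fintype.card V) :
    ∃ f : V →ₗ[ZMod p] ZMod p, ∀ z, ∀ b ∈ B z, b - f z ∈ middleArc p m := by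
  classical
  have hm : 2 ≤ m := by omega
  have hsys := arcSystem_fibres hpm hm h0 hB
  have hsum : ∑ z, (m - (B z).card) + ∑ z, (B z).card = m * Fintype.card V := by
    rw [← Finset.sum_add_distrib, Finset.sum_congr rfl fun z _ =>
      Nat.sub_add_cancel (card_fibre_le hpm hm h0 hB z)]
    simp [mul_comm]
  have hd : 2 * p * ∑ z, (m - (B z).card) + 2 * Fintype.card V ≤ p * Fintype.card V := by
    have := congrArg (2 * p * ·) hsum
    simp only [mul_add, ← mul_assoc] at this
    omega
  obtain ⟨f, hf⟩ := hsys.exists_linear hpm hp _ V _ _ rfl hd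
  refine ⟨f, fun z => ?_⟩
  let X : Finset V := Finset.univ.filter fun x => m - (B x).card = 0
  have hX : Fintype.card V < X.card + X.card := by
    have h1 := card_le_card_zeros_add_sum (Finset.univ : Finset V) fun z => m - (B z).card
    rw [Finset.card_univ] at h1
    change _ ≤ X.card + _ at h1
    have h2 : 0 < Fintype.card V := Fintype.card_pos
    have h3 : 0 < p := by omega
    by_contra! hcon
    have h4 : p * Fintype.card V ≤ p * (2 * ∑ z, (m - (B z).card)) :=
      Nat.mul_le_mul_left _ (by omega)
    have : p * (2 * ∑ z, (m - (B z).card)) = 2 * p * ∑ z, (m - (B z).card) := by ring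
    omega
  obtain ⟨x, hx, hzx⟩ := exists_mem_mem_sub_of_card_lt (F := Finset.univ) (A := X) (B := X) (z := z)
    (Finset.subset_univ _) (fun _ _ => Finset.mem_univ _) (by rwa [Finset.card_univ])
  have hx := (Finset.mem_filter.1 hx).2
  have hzx := (Finset.mem_filter.1 hzx).2
  have := hsys.add_mem (by omega) hx hzx (hf x hx) (hf _ hzx)
  rwa [← map_add, add_sub_cancel] at this

end Fibres

theorem exists_linear_of_sumFree {p m : ℕ} [Fact p.Prime] {G : Type*} [AddCommGroup G]
    [Module (ZMod p) G] [Fintype G] (hpm : p + 1 = 3 * m) (hp : 11 ≤ p) (A : Finset G)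
    (hA : ∀ a ∈ A, ∀ b ∈ A, a + b ∉ A) {Q : ℕ} (hG : Fintype.card G = p * Q) (hQ : 0 < Q)
    (hcard : 2 * p * m * Q + 2 * Q ≤ 2 * p * A.card + p * Q) :
    ∃ (Φ : G →ₗ[ZMod p] ZMod p) (v : G), Φ v = 1 ∧ ∀ a ∈ A, Φ a ∈ middleArc p m := by
  classical
  obtain ⟨v, hv0, hv⟩ := exists_full_line hpm hp A hA hG hQ hcard
  obtain ⟨l, hl⟩ := Module.Projective.exists_dual_eq_one (ZMod p) hv0
  have hl0 : l ≠ 0 := by rintro rfl; simp at hl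
  let K := LinearMap.ker l
  have : Fintype K := Fintype.ofFinite _
  have hK : Fintype.card K = Q := by
    have h1 := card_eq_mul_card_fibre hl0
    rw [hG] at h1
    rw [Nat.eq_of_mul_eq_mul_left (by omega) h1]
    exact Fintype.card_of_subtype _ fun x => by simp [K]
  let π : G →ₗ[ZMod p] K := (LinearMap.id - l.smulRight v).codRestrict K fun x => by
    simp [K, hl]
  have hπ : ∀ a, (π a : G) = a - l a • v := fun a => rfl
  let B : K → Finset (ZMod p) := fun z => Finset.univ.filter fun t => (z : G) + t • v ∈ A
  have hmem : ∀ z t, t ∈ B z ↔ (z : G) + t • v ∈ A := fun z t => by simp [B]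
  have hsum : ∑ z, (B z).card = A.card := by
    rw [Finset.card_eq_sum_card_fiberwise (f := π) (t := Finset.univ) (by simp)]
    refine Finset.sum_congr rfl fun z _ => ?_
    have hz : l z = 0 := z.2
    refine Finset.card_bij' (fun t _ => (z : G) + t • v) (fun a _ => l a) ?_ ?_ ?_ ?_
    · intro t ht
      refine Finset.mem_filter.2 ⟨(hmem z t).1 ht, Subtype.ext ?_⟩
      simp [hπ, hz, hl]
    · intro a ha
      obtain ⟨haA, rfl⟩ := Finset.mem_filter.1 ha
      rw [hmem, hπ, sub_add_cancel]
      exact haA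
    · intro t _
      simp [hz, hl]
    · intro a ha
      obtain ⟨-, rfl⟩ := Finset.mem_filter.1 ha
      simp [hπ]
  obtain ⟨f, hf⟩ := exists_linear_of_fibres hpm hp (B := B)
    (by ext t; rw [hmem]; simpa using hv t)
    (by
      intro x y s hs t ht hst
      rw [hmem] at hs ht hst
      refine hA _ hs _ ht ?_
      convert hst using 1
      push_cast
      module)
    (by rwa [hK, hsum])
  have hπv : π v = 0 := Subtype.ext (by simp [hπ, hl])
  refine ⟨l - f ∘ₗ π, v, by simp [hl, hπv], fun a ha => ?_⟩
  exact hf (π a) (l a) (by rw [hmem, hπ, sub_add_cancel]; exact ha)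

theorem stmt_13 (p : ℕ) [Fact p.Prime] (hp : 11 ≤ p) (hp3 : p % 3 = 2)
    (n : ℕ) (A : Set (Fin n → ZMod p))
    (hsf : ∀ a ∈ A, ∀ b ∈ A, a + b ∉ A)
    (hcard : 2 * p * A.ncard ≥ (2 * p * ((p + 1) / 3) - p + 2) * p ^ (n - 1)) :
    ∃ V : Submodule (ZMod p) (Fin n → ZMod p), Module.finrank (ZMod p) V = n - 1 ∧
      ∃ w : Fin n → ZMod p, w ∉ V ∧
        A ⊆ {a | ∃ k : ℕ, (p + 1) / 3 ≤ k ∧ k ≤ 2 * ((p + 1) / 3) - 1 ∧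
               a - (k : ZMod p) • w ∈ V} := by
  classical
  obtain ⟨m, hm⟩ : ∃ m, m = (p + 1) / 3 := ⟨_, rfl⟩
  have hpm : p + 1 = 3 * m := by omega
  rw [← hm] at hcard ⊢
  rcases n with _ | n
  · have hA : A = ∅ := Set.eq_empty_of_forall_notMem fun a ha =>
      hsf a ha a ha (by rwa [Subsingleton.elim (a + a) a])
    rw [hA] at hcard
    simp at hcard
  · rw [Set.ncard_eq_toFinset_card', Nat.add_sub_cancel] at hcard
    obtain ⟨Φ, v, hv, hΦ⟩ := exists_linear_of_sumFree hpm hp A.toFinset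
      (by simpa using hsf) (Q := p ^ n) (by simp [ZMod.card, pow_succ, mul_comm])
      (by positivity) (by
        have h1 : p ≤ 2 * p * m := by nlinarith
        obtain ⟨c, hc⟩ := Nat.exists_eq_add_of_le h1
        rw [hc, Nat.add_sub_cancel_left] at hcard
        rw [hc]
        linarith)
    refine ⟨LinearMap.ker Φ, ?_, v, by simp [hv], fun a ha => ?_⟩
    · have h1 := LinearMap.finrank_range_add_finrank_ker Φ
      rw [LinearMap.range_eq_top.2 (LinearMap.surjective (by rintro rfl; simp at hv)),
        finrank_top, Module.finrank_self, Module.finrank_fin_fun] at h1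
      omega
    · obtain ⟨k, hk1, hk2, hk⟩ := mem_middleArc.1 (hΦ a (by simpa using ha))
      exact ⟨k, hk1, by omega, by simp [hv, hk]⟩
end
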